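/- arXiv:2401.17219 — 10 statements merged into one kernel-verified Lean document; each statement's English description precedes it below -/
import Mathlib

section
/- Let r ≥ 2, let ℱ be a nondegenerate family of r-graphs, and let ℌ be a hereditary class of ℱ-free r-graphs. If ℱ is both edge-stable and vertex-extendable with respect to ℌ, then ℱ is degree-stable with respect to ℌ. -/
open Finset

/-- An `r`-graph: a collection of `r`-element subsets of a finite vertex set
(taken inside `ℕ`). -/
structure RGraph (r : ℕ) where
  verts : Finset ℕ
  edges : Finset (Finset ℕ)
  edge_sub : ∀ e ∈ edges, e ⊆ verts
  card_edge : ∀ e ∈ edges, e.card = r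

namespace RGraph

variable {r : ℕ}

/-- The degree of a vertex `v`: the number of edges containing `v`. -/
def deg (H : RGraph r) (v : ℕ) : ℕ :=
  (H.edges.filter (fun e => v ∈ e)).card

/-- `G` is a subgraph of `H`. -/
def IsSubgraph (G H : RGraph r) : Prop :=
  G.verts ⊆ H.verts ∧ G.edges ⊆ H.edges

/-- The `r`-graph `H - v` obtained from `H` by deleting the vertex `v` and all
edges containing it. -/
def deleteVert (H : RGraph r) (v : ℕ) : RGraph r where
  verts := H.verts.erase v
  edges := H.edges.filter (fun e => v ∉ e)
  edge_sub := by
    intro e he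
    rw [Finset.mem_filter] at he
    intro x hx
    exact Finset.mem_erase.mpr
      ⟨fun hxv => he.2 (hxv ▸ hx), H.edge_sub e he.1 hx⟩
  card_edge := fun e he => H.card_edge e (Finset.mem_filter.mp he).1

/-- An embedding of `F` into `H`: an injection of the vertex set of `F` into
that of `H` mapping every edge of `F` to an edge of `H`. -/
def Embeds (F H : RGraph r) : Prop :=
  ∃ ψ : ℕ → ℕ, Set.InjOn ψ (F.verts : Set ℕ) ∧
    Set.MapsTo ψ (F.verts : Set ℕ) (H.verts : Set ℕ) ∧
    ∀ e ∈ F.edges, e.image ψ ∈ H.edges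

/-- `H` is `ℱ`-free: no member of `ℱ` embeds into `H`. -/
def Free (ℱ : Set (RGraph r)) (H : RGraph r) : Prop :=
  ∀ F ∈ ℱ, ¬ Embeds F H

end RGraph

/-- The Turán number `ex(n, ℱ)`: the maximum number of edges in an `ℱ`-free
`r`-graph on `n` vertices. -/
noncomputable def exNum (r : ℕ) (ℱ : Set (RGraph r)) (n : ℕ) : ℕ :=
  sSup {m : ℕ | ∃ H : RGraph r,
    H.verts.card = n ∧ RGraph.Free ℱ H ∧ H.edges.card = m}

/-- `ℱ` is edge-stable with respect to `ℌ` (for the density value `piF`):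
for every `δ > 0` there are `ε > 0` and `n₀` such that every `ℱ`-free
`r`-graph `H` on `n ≥ n₀` vertices with at least `(π(ℱ)/r! - ε) n^r` edges
becomes a member of `ℌ` after removing at most `δ n^r` edges. -/
def EdgeStable (r : ℕ) (ℱ ℌ : Set (RGraph r)) (piF : ℝ) : Prop :=
  ∀ δ : ℝ, 0 < δ → ∃ ε : ℝ, 0 < ε ∧ ∃ n₀ : ℕ,
    ∀ H : RGraph r, RGraph.Free ℱ H → n₀ ≤ H.verts.card →
      (piF / (Nat.factorial r : ℝ) - ε) * (H.verts.card : ℝ) ^ r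
          ≤ (H.edges.card : ℝ) →
      ∃ G : RGraph r, G.verts = H.verts ∧ G.edges ⊆ H.edges ∧
        (H.edges.card : ℝ) - (G.edges.card : ℝ)
          ≤ δ * (H.verts.card : ℝ) ^ r ∧ G ∈ ℌ

/-- `ℱ` is degree-stable with respect to `ℌ` (for the density value `piF`):
there are `ε > 0` and `n₀` such that every `ℱ`-free `r`-graph `H` on `n ≥ n₀`
vertices with `δ(H) ≥ (π(ℱ)/(r-1)! - ε) n^{r-1}` is a member of `ℌ`. -/
def DegreeStable (r : ℕ) (ℱ ℌ : Set (RGraph r)) (piF : ℝ) : Prop :=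
  ∃ ε : ℝ, 0 < ε ∧ ∃ n₀ : ℕ,
    ∀ H : RGraph r, RGraph.Free ℱ H → n₀ ≤ H.verts.card →
      (∀ v ∈ H.verts,
        (piF / (Nat.factorial (r - 1) : ℝ) - ε) * (H.verts.card : ℝ) ^ (r - 1)
          ≤ (H.deg v : ℝ)) →
      H ∈ ℌ

/-- `ℱ` is vertex-extendable with respect to `ℌ` (for the density value
`piF`): there are `ε > 0` and `n₀` such that for every `ℱ`-free `r`-graph `H`
on `n ≥ n₀` vertices with `δ(H) ≥ (π(ℱ)/(r-1)! - ε) n^{r-1}` and every vertex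
`v`, if `H - v ∈ ℌ` then `H ∈ ℌ`. -/
def VertexExtendable (r : ℕ) (ℱ ℌ : Set (RGraph r)) (piF : ℝ) : Prop :=
  ∃ ε : ℝ, 0 < ε ∧ ∃ n₀ : ℕ,
    ∀ H : RGraph r, RGraph.Free ℱ H → n₀ ≤ H.verts.card →
      (∀ v ∈ H.verts,
        (piF / (Nat.factorial (r - 1) : ℝ) - ε) * (H.verts.card : ℝ) ^ (r - 1)
          ≤ (H.deg v : ℝ)) →
      ∀ v ∈ H.verts, H.deleteVert v ∈ ℌ → H ∈ ℌ

namespace RGraph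

theorem Free.mono {r : ℕ} {ℱ : Set (RGraph r)} {G H : RGraph r} (hH : Free ℱ H)
    (h : G.IsSubgraph H) : Free ℱ G := by
  rintro F hF ⟨ψ, hinj, hmaps, hedge⟩
  exact hH F hF ⟨ψ, hinj, fun x hx => h.1 (hmaps hx), fun e he => h.2 (hedge e he)⟩

/-- Handshake lemma for `r`-graphs. -/
theorem sum_deg {r : ℕ} (H : RGraph r) {V : Finset ℕ} (hV : H.verts ⊆ V) :
    ∑ v ∈ V, H.deg v = r * H.edges.card := by
  simp only [deg, card_filter]
  rw [sum_comm, mul_comm, ← smul_eq_mul, ← sum_const]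
  refine sum_congr rfl fun e he => ?_
  rw [← card_filter, filter_mem_eq_inter, inter_eq_right.mpr ((H.edge_sub e he).trans hV),
    H.card_edge e he]

theorem deg_mono {r : ℕ} {G H : RGraph r} (h : G.edges ⊆ H.edges) (v : ℕ) :
    G.deg v ≤ H.deg v :=
  card_le_card (filter_subset_filter _ h)

/-- Two distinct vertices lie in at most `n ^ (r - 2)` common edges. -/
theorem codegree_le {s : ℕ} (H : RGraph (s + 2)) {v z : ℕ} (hvz : v ≠ z) :
    (H.edges.filter (fun e => v ∈ e ∧ z ∈ e)).card ≤ H.verts.card ^ s := by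
  calc (H.edges.filter (fun e => v ∈ e ∧ z ∈ e)).card
      ≤ (H.verts.powersetCard s).card := by
        refine card_le_card_of_injOn (fun e => (e.erase v).erase z) ?_ ?_
        · intro e he
          obtain ⟨he, hv, hz⟩ := mem_filter.mp he
          refine mem_powersetCard.mpr
            ⟨(erase_subset _ _).trans ((erase_subset _ _).trans (H.edge_sub e he)), ?_⟩
          rw [card_erase_of_mem (mem_erase.mpr ⟨hvz.symm, hz⟩), card_erase_of_mem hv,
            H.card_edge e he]
          rfl
        · intro e he f hf hef
          obtain ⟨-, hve, hze⟩ := mem_filter.mp he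
          obtain ⟨-, hvf, hzf⟩ := mem_filter.mp hf
          have h : insert v (insert z ((e.erase v).erase z))
              = insert v (insert z ((f.erase v).erase z)) :=
            congrArg (fun t => insert v (insert z t)) hef
          rwa [insert_erase (mem_erase.mpr ⟨hvz.symm, hze⟩), insert_erase hve,
            insert_erase (mem_erase.mpr ⟨hvz.symm, hzf⟩), insert_erase hvf] at h
    _ = H.verts.card.choose s := card_powersetCard _ _
    _ ≤ H.verts.card ^ s := Nat.choose_le_pow _ _

/-- At most `|Z| n ^ (r - 2)` edges through `v` meet `Z` in a vertex other than `v`. -/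
theorem deg_le_card_filter_add {s : ℕ} (H : RGraph (s + 2)) (Z : Finset ℕ) (v : ℕ) :
    H.deg v ≤ (H.edges.filter (fun e => v ∈ e ∧ ∀ z ∈ e, z ∈ Z → z = v)).card
      + Z.card * H.verts.card ^ s := by
  have hsub : H.edges.filter (fun e => v ∈ e) ⊆
      H.edges.filter (fun e => v ∈ e ∧ ∀ z ∈ e, z ∈ Z → z = v) ∪
        (Z.erase v).biUnion (fun z => H.edges.filter (fun e => v ∈ e ∧ z ∈ e)) := by
    intro e he
    obtain ⟨he, hv⟩ := mem_filter.mp he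
    by_cases h : ∀ z ∈ e, z ∈ Z → z = v
    · exact mem_union_left _ (mem_filter.mpr ⟨he, hv, h⟩)
    · push Not at h
      obtain ⟨z, hze, hzZ, hzv⟩ := h
      exact mem_union_right _ (mem_biUnion.mpr
        ⟨z, mem_erase.mpr ⟨hzv, hzZ⟩, mem_filter.mpr ⟨he, hv, hze⟩⟩)
  refine (card_le_card hsub).trans ((card_union_le _ _).trans (Nat.add_le_add_left ?_ _))
  refine (card_biUnion_le_card_mul _ _ (H.verts.card ^ s) fun z hz => ?_).trans
    (Nat.mul_le_mul_right _ (card_le_card (erase_subset _ _)))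
  exact H.codegree_le (ne_of_mem_erase hz).symm

/-- The graph interpolating between `G - Z` (at `U = ∅`) and `H` (at `U = V(H)`): delete the
vertices in `Z \ U`, and keep the edges that lie in `G` or meet `U`. -/
def interpolate {r : ℕ} (H G : RGraph r) (Z U : Finset ℕ) : RGraph r where
  verts := H.verts.filter (fun x => x ∈ Z → x ∈ U)
  edges := H.edges.filter
    (fun e => (∀ x ∈ e, x ∈ Z → x ∈ U) ∧ (e ∈ G.edges ∨ ∃ x ∈ e, x ∈ U))
  edge_sub := fun e he x hx =>
    mem_filter.mpr ⟨H.edge_sub e (mem_filter.mp he).1 hx, (mem_filter.mp he).2.1 x hx⟩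
  card_edge := fun e he => H.card_edge e (mem_filter.mp he).1

theorem interpolate_isSubgraph {r : ℕ} (H G : RGraph r) (Z U : Finset ℕ) :
    (H.interpolate G Z U).IsSubgraph H :=
  ⟨filter_subset _ _, filter_subset _ _⟩

theorem interpolate_empty_isSubgraph {r : ℕ} {H G : RGraph r} (hv : G.verts = H.verts)
    (Z : Finset ℕ) : (H.interpolate G Z ∅).IsSubgraph G := by
  refine ⟨hv ▸ filter_subset _ _, fun e he => ?_⟩
  simpa using (mem_filter.mp he).2.2

theorem isSubgraph_interpolate_verts {r : ℕ} (hr : r ≠ 0) (H G : RGraph r) (Z : Finset ℕ) :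
    H.IsSubgraph (H.interpolate G Z H.verts) := by
  refine ⟨fun x hx => mem_filter.mpr ⟨hx, fun _ => hx⟩, fun e he => mem_filter.mpr
    ⟨he, fun x hx _ => H.edge_sub e he hx, Or.inr ?_⟩⟩
  obtain ⟨x, hx⟩ : e.Nonempty := card_pos.mp (by rw [H.card_edge e he]; omega)
  exact ⟨x, hx, H.edge_sub e he hx⟩

theorem deleteVert_interpolate_insert_isSubgraph {r : ℕ} (H G : RGraph r) (Z U : Finset ℕ)
    (v : ℕ) : ((H.interpolate G Z (insert v U)).deleteVert v).IsSubgraph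
      (H.interpolate G Z U) := by
  constructor
  · intro x hx
    obtain ⟨hxv, hx⟩ := mem_erase.mp hx
    obtain ⟨hx, hU⟩ := mem_filter.mp hx
    exact mem_filter.mpr ⟨hx, fun hZ => (mem_insert.mp (hU hZ)).resolve_left hxv⟩
  · intro e he
    obtain ⟨he, hve⟩ := mem_filter.mp he
    obtain ⟨he, hU, hor⟩ := mem_filter.mp he
    have hmem : ∀ x ∈ e, x ∈ insert v U → x ∈ U := fun x hx h =>
      (mem_insert.mp h).resolve_left fun hxv => hve (hxv ▸ hx)
    exact mem_filter.mpr ⟨he, fun x hx hZ => hmem x hx (hU x hx hZ),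
      hor.imp_right fun ⟨x, hx, h⟩ => ⟨x, hx, hmem x hx h⟩⟩

theorem deg_le_deg_interpolate_add {s : ℕ} {H G : RGraph (s + 2)} (hv : G.verts = H.verts)
    (hG : G.edges ⊆ H.edges) (Z U : Finset ℕ) {v : ℕ}
    (hvert : v ∈ (H.interpolate G Z U).verts) :
    G.deg v ≤ (H.interpolate G Z U).deg v + Z.card * H.verts.card ^ s := by
  obtain ⟨-, hvU⟩ := mem_filter.mp hvert
  have h := G.deg_le_card_filter_add Z v
  rw [hv] at h
  refine h.trans (Nat.add_le_add_right (card_le_card fun e he => ?_) _)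
  obtain ⟨he, hve, hZ⟩ := mem_filter.mp he
  exact mem_filter.mpr ⟨mem_filter.mpr
    ⟨hG he, fun x hx hxZ => hZ x hx hxZ ▸ hvU (hZ x hx hxZ ▸ hxZ), Or.inl he⟩, hve⟩

theorem deg_le_deg_interpolate_add_of_mem {s : ℕ} (H G : RGraph (s + 2)) (Z : Finset ℕ)
    {U : Finset ℕ} {v : ℕ} (hvU : v ∈ U) :
    H.deg v ≤ (H.interpolate G Z U).deg v + Z.card * H.verts.card ^ s := by
  refine (H.deg_le_card_filter_add Z v).trans
    (Nat.add_le_add_right (card_le_card fun e he => ?_) _)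
  obtain ⟨he, hve, hZ⟩ := mem_filter.mp he
  exact mem_filter.mpr ⟨mem_filter.mpr
    ⟨he, fun x hx hxZ => (hZ x hx hxZ).symm ▸ hvU, Or.inr ⟨v, hve, hvU⟩⟩, hve⟩

/-- If `v` has lost few edges from `H` to `G` unless it lies in `Z`, then the interpolating
graph loses few edges at each of its vertices. -/
theorem deg_le_deg_interpolate_of_loss {s : ℕ} {H G : RGraph (s + 2)}
    (hv : G.verts = H.verts) (hG : G.edges ⊆ H.edges) {Z : Finset ℕ} {c : ℝ} (hc : 0 ≤ c)
    (hZcard : (Z.card : ℝ) ≤ c * H.verts.card)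
    (hZ : ∀ v ∈ H.verts, v ∉ Z → (H.deg v : ℝ) ≤ G.deg v + c * (H.verts.card : ℝ) ^ (s + 1))
    (U : Finset ℕ) {v : ℕ} (hvert : v ∈ (H.interpolate G Z U).verts) :
    (H.deg v : ℝ) ≤ (H.interpolate G Z U).deg v + 2 * c * (H.verts.card : ℝ) ^ (s + 1) := by
  obtain ⟨hvH, hvU⟩ := mem_filter.mp hvert
  have hpow : (Z.card : ℝ) * (H.verts.card : ℝ) ^ s ≤ c * (H.verts.card : ℝ) ^ (s + 1) := by
    rw [pow_succ', ← mul_assoc]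
    gcongr
  have hnonneg : 0 ≤ c * (H.verts.card : ℝ) ^ (s + 1) := by positivity
  by_cases hmem : v ∈ U
  · have h : (H.deg v : ℝ) ≤ (H.interpolate G Z U).deg v + Z.card * (H.verts.card : ℝ) ^ s := by
      exact_mod_cast H.deg_le_deg_interpolate_add_of_mem G Z hmem
    linarith
  · have h : (G.deg v : ℝ) ≤ (H.interpolate G Z U).deg v + Z.card * (H.verts.card : ℝ) ^ s := by
      exact_mod_cast deg_le_deg_interpolate_add hv hG Z U hvert
    linarith [hZ v hvH fun h => hmem (hvU h)]

/-- If `H` and `G` differ in few edges then few vertices lose many edges. -/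
theorem card_filter_loss_le {s : ℕ} {H G : RGraph (s + 2)} (hv : G.verts = H.verts)
    (hG : G.edges ⊆ H.edges) {c : ℝ} (hc : 0 < c) (hn : 0 < H.verts.card)
    (hloss : (H.edges.card : ℝ) - G.edges.card
      ≤ c ^ 2 / (s + 2 : ℕ) * (H.verts.card : ℝ) ^ (s + 2)) :
    ((H.verts.filter fun v =>
      (G.deg v : ℝ) + c * (H.verts.card : ℝ) ^ (s + 1) < H.deg v).card : ℝ)
      ≤ c * H.verts.card := by
  set Z := H.verts.filter fun v =>
      (G.deg v : ℝ) + c * (H.verts.card : ℝ) ^ (s + 1) < H.deg v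
  have hH : ∑ v ∈ H.verts, (H.deg v : ℝ) = (s + 2 : ℕ) * H.edges.card := by
    exact_mod_cast H.sum_deg subset_rfl
  have hGsum : ∑ v ∈ H.verts, (G.deg v : ℝ) = (s + 2 : ℕ) * G.edges.card := by
    exact_mod_cast G.sum_deg hv.subset
  have hlow : (Z.card : ℝ) * (c * (H.verts.card : ℝ) ^ (s + 1))
      ≤ ∑ v ∈ Z, ((H.deg v : ℝ) - G.deg v) := by
    rw [← nsmul_eq_mul]
    refine card_nsmul_le_sum _ _ _ fun v hvZ => ?_
    linarith [(mem_filter.mp hvZ).2]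
  have hup : ∑ v ∈ Z, ((H.deg v : ℝ) - G.deg v) ≤ ∑ v ∈ H.verts, ((H.deg v : ℝ) - G.deg v) :=
    sum_le_sum_of_subset_of_nonneg (filter_subset _ _) fun v _ _ =>
      sub_nonneg.mpr (by exact_mod_cast deg_mono hG v)
  rw [sum_sub_distrib (s := H.verts), hH, hGsum, ← mul_sub] at hup
  have hr : (0 : ℝ) < (s + 2 : ℕ) := by positivity
  have hmul := mul_le_mul_of_nonneg_left hloss hr.le
  have heq : ((s + 2 : ℕ) : ℝ) * (c ^ 2 / (s + 2 : ℕ) * (H.verts.card : ℝ) ^ (s + 2))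
      = c * H.verts.card * (c * (H.verts.card : ℝ) ^ (s + 1)) := by
    field_simp
    ring
  rw [heq] at hmul
  exact le_of_mul_le_mul_right (hlow.trans (hup.trans hmul)) (by positivity)

/-- A minimum degree condition implies the corresponding edge density condition. -/
theorem le_card_edges_of_le_deg {s : ℕ} (H : RGraph (s + 2)) {p ε : ℝ} (hε : 0 ≤ ε)
    (hdeg : ∀ v ∈ H.verts,
      (p / (Nat.factorial (s + 1) : ℝ) - ε) * (H.verts.card : ℝ) ^ (s + 1) ≤ H.deg v) :
    (p / (Nat.factorial (s + 2) : ℝ) - ε) * (H.verts.card : ℝ) ^ (s + 2) ≤ H.edges.card := by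
  have hH : ∑ v ∈ H.verts, (H.deg v : ℝ) = (s + 2 : ℕ) * H.edges.card := by
    exact_mod_cast H.sum_deg subset_rfl
  have hsum := card_nsmul_le_sum _ _ _ hdeg
  rw [hH, nsmul_eq_mul] at hsum
  have hr : (1 : ℝ) ≤ (s + 2 : ℕ) := by exact_mod_cast (by omega : 1 ≤ s + 2)
  refine le_of_mul_le_mul_left (le_trans ?_ hsum) (by linarith : (0 : ℝ) < (s + 2 : ℕ))
  have hfac : ((s + 2 : ℕ) : ℝ) * (p / (Nat.factorial (s + 2) : ℝ))
      = p / (Nat.factorial (s + 1) : ℝ) := by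
    have : (Nat.factorial (s + 1) : ℝ) ≠ 0 := by positivity
    rw [Nat.factorial_succ (s + 1)]
    push_cast
    field_simp
    ring
  have hpow : (0 : ℝ) ≤ (H.verts.card : ℝ) ^ (s + 2) := by positivity
  calc ((s + 2 : ℕ) : ℝ) *
        ((p / (Nat.factorial (s + 2) : ℝ) - ε) * (H.verts.card : ℝ) ^ (s + 2))
      = (p / (Nat.factorial (s + 1) : ℝ) - (s + 2 : ℕ) * ε) * (H.verts.card : ℝ) ^ (s + 2) := by
        rw [← mul_assoc, mul_sub, hfac]
    _ ≤ (p / (Nat.factorial (s + 1) : ℝ) - ε) * (H.verts.card : ℝ) ^ (s + 2) := by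
        gcongr
        exact le_mul_of_one_le_left hε hr
    _ = _ := by ring

end RGraph

/-- **A criterion for Andrásfai–Erdős–Sós type theorems.**
Let `r ≥ 2`, let `ℱ` be a nondegenerate family of `r`-graphs (i.e. its Turán
density `piF = lim ex(n,ℱ)/C(n,r)` is positive), and let `ℌ` be a hereditary
class of `ℱ`-free `r`-graphs. If `ℱ` is both edge-stable and vertex-extendable
with respect to `ℌ`, then `ℱ` is degree-stable with respect to `ℌ`. -/
theorem degreeStable_of_edgeStable_of_vertexExtendable
    (r : ℕ) (hr : 2 ≤ r) (ℱ ℌ : Set (RGraph r)) (piF : ℝ)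
    (hlim : Filter.Tendsto
      (fun n : ℕ => (exNum r ℱ n : ℝ) / (n.choose r : ℝ))
      Filter.atTop (nhds piF))
    (hpos : 0 < piF)
    (hHfree : ∀ H ∈ ℌ, RGraph.Free ℱ H)
    (hHered : ∀ H ∈ ℌ, ∀ G : RGraph r, G.IsSubgraph H → G ∈ ℌ)
    (hes : EdgeStable r ℱ ℌ piF)
    (hve : VertexExtendable r ℱ ℌ piF) :
    DegreeStable r ℱ ℌ piF := by
  obtain ⟨s, rfl⟩ : ∃ s, r = s + 2 := ⟨r - 2, by omega⟩
  have hsub : s + 2 - 1 = s + 1 := rfl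
  obtain ⟨ε₀, hε₀, n₁, hve⟩ := hve
  obtain ⟨c, hc, hcε, hc2⟩ : ∃ c : ℝ, 0 < c ∧ 4 * c ≤ ε₀ ∧ 2 * c ≤ 1 :=
    ⟨min (ε₀ / 4) (1 / 2), by positivity, by linarith [min_le_left (ε₀ / 4) (1 / 2)],
      by linarith [min_le_right (ε₀ / 4) (1 / 2)]⟩
  obtain ⟨ε₁, hε₁, n₂, hes⟩ := hes (c ^ 2 / (s + 2 : ℕ)) (by positivity)
  refine ⟨min (ε₀ / 2) ε₁, by positivity, max (2 * n₁) (max n₂ 1), fun H hfree hn hdeg => ?_⟩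
  rw [hsub] at hdeg hve
  have hn₁ : 2 * n₁ ≤ H.verts.card := (le_max_left _ _).trans hn
  have hn₂ : n₂ ≤ H.verts.card := (le_max_left _ _).trans ((le_max_right _ _).trans hn)
  have hn₀ : 0 < H.verts.card := (le_max_right _ _).trans ((le_max_right _ _).trans hn)
  obtain ⟨G, hGv, hGe, hloss, hGmem⟩ := hes H hfree hn₂ <| by
    refine H.le_card_edges_of_le_deg hε₁.le fun v hv => le_trans ?_ (hdeg v hv)
    gcongr
    exact min_le_right _ _
  set Z := H.verts.filter fun v =>
    (G.deg v : ℝ) + c * (H.verts.card : ℝ) ^ (s + 1) < H.deg v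
  have hZcard : (Z.card : ℝ) ≤ c * H.verts.card :=
    RGraph.card_filter_loss_le hGv hGe hc hn₀ hloss
  have hZloss : ∀ v ∈ H.verts, v ∉ Z →
      (H.deg v : ℝ) ≤ G.deg v + c * (H.verts.card : ℝ) ^ (s + 1) := fun v hv hvZ =>
    not_lt.mp fun h => hvZ (mem_filter.mpr ⟨hv, h⟩)
  have hlarge : ∀ U, n₁ ≤ (H.interpolate G Z U).verts.card := by
    intro U
    have h₁ : H.verts \ Z ⊆ (H.interpolate G Z U).verts := fun x hx =>
      mem_filter.mpr ⟨(mem_sdiff.mp hx).1, fun h => absurd h (mem_sdiff.mp hx).2⟩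
    have h₂ : H.verts.card ≤ (H.interpolate G Z U).verts.card + Z.card :=
      card_le_card_sdiff_add_card.trans (Nat.add_le_add_right (card_le_card h₁) _)
    have h₃ : 2 * (Z.card : ℝ) ≤ H.verts.card := by nlinarith
    have h₄ : 2 * Z.card ≤ H.verts.card := by exact_mod_cast h₃
    omega
  have hmindeg : ∀ U, ∀ v ∈ (H.interpolate G Z U).verts,
      (piF / (Nat.factorial (s + 1) : ℝ) - ε₀) *
        ((H.interpolate G Z U).verts.card : ℝ) ^ (s + 1) ≤ (H.interpolate G Z U).deg v := by
    intro U v hv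
    rcases le_total (piF / (Nat.factorial (s + 1) : ℝ) - ε₀) 0 with hneg | hnonneg
    · exact (mul_nonpos_of_nonpos_of_nonneg hneg (by positivity)).trans (Nat.cast_nonneg _)
    · have hcard : ((H.interpolate G Z U).verts.card : ℝ) ≤ H.verts.card := by
        exact_mod_cast card_le_card (H.interpolate_isSubgraph G Z U).1
      have hvH : v ∈ H.verts := (H.interpolate_isSubgraph G Z U).1 hv
      have hcoef : piF / (Nat.factorial (s + 1) : ℝ) - ε₀
          ≤ piF / (Nat.factorial (s + 1) : ℝ) - min (ε₀ / 2) ε₁ - 2 * c := by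
        linarith [min_le_left (ε₀ / 2) ε₁]
      calc _ ≤ (piF / (Nat.factorial (s + 1) : ℝ) - ε₀) * (H.verts.card : ℝ) ^ (s + 1) := by
            gcongr
        _ ≤ (piF / (Nat.factorial (s + 1) : ℝ) - min (ε₀ / 2) ε₁ - 2 * c) *
              (H.verts.card : ℝ) ^ (s + 1) := by gcongr
        _ ≤ _ := by
            linarith [hdeg v hvH,
              RGraph.deg_le_deg_interpolate_of_loss hGv hGe hc.le hZcard hZloss U hv]
  have hmem : ∀ U ⊆ H.verts, H.interpolate G Z U ∈ ℌ := by
    intro U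
    induction U using Finset.induction_on with
    | empty => exact fun _ => hHered G hGmem _ (RGraph.interpolate_empty_isSubgraph hGv Z)
    | insert v U _ ih =>
      intro hU
      refine hve _ (hfree.mono (H.interpolate_isSubgraph G Z _)) (hlarge _) (hmindeg _) v
        (mem_filter.mpr ⟨hU (mem_insert_self v U), fun _ => mem_insert_self v U⟩) ?_
      exact hHered _ (ih ((subset_insert v U).trans hU)) _
        (H.deleteVert_interpolate_insert_isSubgraph G Z U v)
  exact hHered _ (hmem H.verts subset_rfl) H
    (H.isSubgraph_interpolate_verts (Nat.succ_ne_zero _) G Z)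
end

section
/- Let ℓ ≥ 2 and let G be a graph on n vertices with δ(G) > ((3ℓ−4)/(3ℓ−1))·n. If φ and ψ are both proper colorings of G with colors in {1,…,ℓ} (equivalently, graph homomorphisms from G to K_ℓ), then there exists a permutation σ of {1,…,ℓ} such that ψ = σ∘φ. In other words, the homomorphism from G to K_ℓ, if it exists, is unique up to an automorphism of K_ℓ. -/
theorem minDegree_le_card {V : Type*} [Fintype V] (G : SimpleGraph V) [DecidableRel G.Adj] :
    G.minDegree ≤ Fintype.card V := by
  cases isEmpty_or_nonempty V
  · simp
  · exact G.minDegree_lt_card.le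

open Finset in
theorem card_add_minDegree_le_of_forall_not_adj {V : Type*} [Fintype V] (G : SimpleGraph V)
    [DecidableRel G.Adj] (v : V) (S : Finset V) (hS : ∀ u ∈ S, ¬ G.Adj v u) :
    #S + G.minDegree ≤ Fintype.card V := by
  classical
  have hdisj : Disjoint S (G.neighborFinset v) := by
    rw [Finset.disjoint_left]
    intro u hu hadj
    exact hS u hu ((G.mem_neighborFinset v u).1 hadj)
  have hcard : #S + G.degree v ≤ Fintype.card V := by
    rw [← G.card_neighborFinset_eq_degree, ← card_union_of_disjoint hdisj]
    exact card_le_univ _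
  have := G.minDegree_le_degree v
  lia

open Finset in
theorem card_colorClass_add_minDegree_le {V α : Type*} [Fintype V] [DecidableEq α]
    (G : SimpleGraph V) [DecidableRel G.Adj] (φ : V → α)
    (hφ : ∀ u v : V, G.Adj u v → φ u ≠ φ v) (i : α) :
    #{v | φ v = i} + G.minDegree ≤ Fintype.card V := by
  rcases ({v | φ v = i} : Finset V).eq_empty_or_nonempty with he | ⟨v, hv⟩
  · simpa only [he, card_empty, zero_add] using minDegree_le_card G
  · refine card_add_minDegree_le_of_forall_not_adj G v _ fun u hu hadj => hφ v u hadj ?_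
    simp_all

open Finset in
theorem card_le_card_colorClass_add {V : Type*} [Fintype V] {ℓ : ℕ}
    (G : SimpleGraph V) [DecidableRel G.Adj] (φ : V → Fin ℓ)
    (hφ : ∀ u v : V, G.Adj u v → φ u ≠ φ v) (i : Fin ℓ) :
    (Fintype.card V : ℝ) ≤
      #{v | φ v = i} + ((ℓ : ℝ) - 1) * (Fintype.card V - G.minDegree) := by
  have hsum : (Fintype.card V : ℝ) = ∑ j, (#{v | φ v = j} : ℝ) := by
    rw [← Finset.card_univ]
    exact_mod_cast card_eq_sum_card_fiberwise (f := φ) (s := univ) (t := univ) (by simp)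
  have hle : ∑ j ∈ univ.erase i, (#{v | φ v = j} : ℝ) ≤
      #(univ.erase i) • ((Fintype.card V : ℝ) - G.minDegree) := by
    refine sum_le_card_nsmul _ _ _ fun j _ => ?_
    have : (#{v | φ v = j} : ℝ) + G.minDegree ≤ Fintype.card V := by
      exact_mod_cast card_colorClass_add_minDegree_le G φ hφ j
    linarith
  have hℓ : ((ℓ - 1 : ℕ) : ℝ) = (ℓ : ℝ) - 1 := Nat.cast_pred i.pos
  rw [card_erase_of_mem (mem_univ i), card_univ, Fintype.card_fin, nsmul_eq_mul, hℓ] at hle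
  rw [← add_sum_erase univ _ (mem_univ i)] at hsum
  linarith

open Finset in
theorem two_mul_lt_three_mul_card_colorClass {V : Type*} [Fintype V] {ℓ : ℕ}
    (G : SimpleGraph V) [DecidableRel G.Adj]
    (hdeg : (3 * (ℓ : ℝ) - 4) / (3 * (ℓ : ℝ) - 1) * (Fintype.card V : ℝ)
      < (G.minDegree : ℝ))
    (φ : V → Fin ℓ) (hφ : ∀ u v : V, G.Adj u v → φ u ≠ φ v) (i : Fin ℓ) :
    2 * ((Fintype.card V : ℝ) - G.minDegree) < 3 * #{v | φ v = i} := by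
  have hℓ : (1 : ℝ) ≤ ℓ := by exact_mod_cast i.pos
  rw [div_mul_eq_mul_div, div_lt_iff₀ (by linarith)] at hdeg
  have := card_le_card_colorClass_add G φ hφ i
  linarith

open Finset in
theorem card_colorClass_add_card_colorClass_add_minDegree_le {V α β : Type*} [Fintype V]
    [DecidableEq α] [DecidableEq β] (G : SimpleGraph V) [DecidableRel G.Adj]
    (φ : V → α) (ψ : V → β) (hφ : ∀ u v : V, G.Adj u v → φ u ≠ φ v)
    (hψ : ∀ u v : V, G.Adj u v → ψ u ≠ ψ v) (v : V) :
    #{u | φ u = φ v} + #{u | ψ u = ψ v} + G.minDegree ≤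
      Fintype.card V + #{u | φ u = φ v ∧ ψ u = ψ v} := by
  classical
  have hunion := card_add_minDegree_le_of_forall_not_adj G v
    (({u | φ u = φ v} : Finset V) ∪ ({u | ψ u = ψ v} : Finset V)) (by
      intro u hu hadj
      rcases mem_union.1 hu with h | h
      · exact hφ v u hadj (mem_filter.1 h).2.symm
      · exact hψ v u hadj (mem_filter.1 h).2.symm)
  have hcard := card_union_add_card_inter
    ({u | φ u = φ v} : Finset V) ({u | ψ u = ψ v} : Finset V)
  rw [← filter_and] at hcard
  lia

open Finset in
theorem eq_of_eq_of_minDegree_gt {V : Type*} [Fintype V] {ℓ : ℕ}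
    (G : SimpleGraph V) [DecidableRel G.Adj]
    (hdeg : (3 * (ℓ : ℝ) - 4) / (3 * (ℓ : ℝ) - 1) * (Fintype.card V : ℝ)
      < (G.minDegree : ℝ))
    (φ ψ : V → Fin ℓ)
    (hφ : ∀ u v : V, G.Adj u v → φ u ≠ φ v)
    (hψ : ∀ u v : V, G.Adj u v → ψ u ≠ ψ v) {v w : V} (h : φ v = φ w) : ψ v = ψ w := by
  classical
  by_contra hne
  have hv := card_colorClass_add_card_colorClass_add_minDegree_le G φ ψ hφ hψ v
  have hw := card_colorClass_add_card_colorClass_add_minDegree_le G φ ψ hφ hψ w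
  rw [h] at hv
  have hsub : #{u | φ u = φ w ∧ ψ u = ψ v} + #{u | φ u = φ w ∧ ψ u = ψ w} ≤
      #{u | φ u = φ w} := by
    rw [← card_union_of_disjoint]
    · refine card_le_card fun u hu => ?_
      simp only [mem_union, mem_filter, mem_univ, true_and] at hu ⊢
      tauto
    · rw [Finset.disjoint_left]
      intro u hu hu'
      simp only [mem_filter, mem_univ, true_and] at hu hu'
      exact hne (hu.2.symm.trans hu'.2)
  have htotal : (#{u | φ u = φ w} + #{u | ψ u = ψ v} + #{u | ψ u = ψ w}
      + 2 * G.minDegree : ℝ) ≤ 2 * Fintype.card V := by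
    exact_mod_cast (by lia : #{u | φ u = φ w} + #{u | ψ u = ψ v} + #{u | ψ u = ψ w}
      + 2 * G.minDegree ≤ 2 * Fintype.card V)
  have h₁ := two_mul_lt_three_mul_card_colorClass G hdeg φ hφ (φ w)
  have h₂ := two_mul_lt_three_mul_card_colorClass G hdeg ψ hψ (ψ v)
  have h₃ := two_mul_lt_three_mul_card_colorClass G hdeg ψ hψ (ψ w)
  linarith

theorem surjective_of_minDegree_gt {V : Type*} [Fintype V] {ℓ : ℕ}
    (G : SimpleGraph V) [DecidableRel G.Adj]
    (hdeg : (3 * (ℓ : ℝ) - 4) / (3 * (ℓ : ℝ) - 1) * (Fintype.card V : ℝ)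
      < (G.minDegree : ℝ))
    (φ : V → Fin ℓ) (hφ : ∀ u v : V, G.Adj u v → φ u ≠ φ v) : Function.Surjective φ := by
  intro i
  have hlt := two_mul_lt_three_mul_card_colorClass G hdeg φ hφ i
  have hle : (G.minDegree : ℝ) ≤ Fintype.card V := by exact_mod_cast minDegree_le_card G
  have hpos : 0 < (Finset.card {v | φ v = i} : ℝ) := by linarith
  obtain ⟨v, hv⟩ := Finset.card_pos.1 (by exact_mod_cast hpos)
  exact ⟨v, (Finset.mem_filter.1 hv).2⟩

/-- Let `ℓ ≥ 2` and let `G` be a graph on `n` vertices with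
`δ(G) > ((3ℓ-4)/(3ℓ-1)) n`. If `φ` and `ψ` are both proper colorings of `G` with
colors in `Fin ℓ` (equivalently, graph homomorphisms from `G` to `K_ℓ`), then
`ψ = σ ∘ φ` for some permutation `σ` of the colors; i.e. the homomorphism from
`G` to `K_ℓ`, if it exists, is unique up to an automorphism of `K_ℓ`. -/
theorem hom_to_complete_unique {V : Type*} [Fintype V] (ℓ : ℕ) (hℓ : 2 ≤ ℓ)
    (G : SimpleGraph V) [DecidableRel G.Adj]
    (hdeg : (3 * (ℓ : ℝ) - 4) / (3 * (ℓ : ℝ) - 1) * (Fintype.card V : ℝ)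
      < (G.minDegree : ℝ))
    (φ ψ : V → Fin ℓ)
    (hφ : ∀ u v : V, G.Adj u v → φ u ≠ φ v)
    (hψ : ∀ u v : V, G.Adj u v → ψ u ≠ ψ v) :
    ∃ σ : Equiv.Perm (Fin ℓ), ψ = σ ∘ φ := by
  have hfactor : ∀ v, ψ (Function.surjInv (surjective_of_minDegree_gt G hdeg φ hφ) (φ v)) = ψ v :=
    fun v => eq_of_eq_of_minDegree_gt G hdeg φ ψ hφ hψ (Function.surjInv_eq _ _)
  have hsurj : Function.Surjective
      (ψ ∘ Function.surjInv (surjective_of_minDegree_gt G hdeg φ hφ)) := by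
    intro j
    obtain ⟨v, rfl⟩ := surjective_of_minDegree_gt G hdeg ψ hψ j
    exact ⟨φ v, hfactor v⟩
  exact ⟨Equiv.ofBijective _ (Finite.surjective_iff_bijective.1 hsurj),
    funext fun v => (hfactor v).symm⟩
end

section
/- Let ℓ ≥ 2, let α be a real number with α > (3ℓ−4)/(3ℓ−1), and let G be a graph on n ≥ 1 vertices with δ(G) ≥ αn whose vertex set is partitioned into ℓ independent sets U_1, …, U_ℓ. Then for every i ∈ {1,…,ℓ} and all vertices u, u' ∈ U_i, the Hamming distance satisfies |N_G(u) △ N_G(u')| < 2n/(3ℓ−1). -/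
/-- An independent set and the neighborhoods of two of its vertices `u`, `v` satisfy
`|S| + |N(v)| + |N(u) \ N(v)| ≤ |V|`. -/
theorem card_add_degree_add_card_sdiff_le {V : Type*} [Fintype V] [DecidableEq V]
    (G : SimpleGraph V) [DecidableRel G.Adj] (S : Finset V)
    (hS : ∀ u ∈ S, ∀ v ∈ S, ¬ G.Adj u v) {u v : V} (hu : u ∈ S) (hv : v ∈ S) :
    S.card + G.degree v + (G.neighborFinset u \ G.neighborFinset v).card
      ≤ Fintype.card V := by
  rw [← G.card_neighborFinset_eq_degree, ← Finset.card_union_of_disjoint,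
    ← Finset.card_union_of_disjoint]
  · exact Finset.card_le_univ _
  · rw [Finset.disjoint_left]
    intro x hx hx'
    simp only [Finset.mem_union, Finset.mem_sdiff, SimpleGraph.mem_neighborFinset] at hx hx'
    exact hx.elim (fun h => hS u hu x h hx'.1) hx'.2
  · rw [Finset.disjoint_left]
    intro x hx hx'
    exact hS v hv x hx ((G.mem_neighborFinset v x).1 hx')


/-- Let `ℓ ≥ 2`, let `α > (3ℓ-4)/(3ℓ-1)`, and let `G` be a graph on `n ≥ 1`
vertices with `δ(G) ≥ α n` whose vertex set is partitioned into `ℓ` independent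
sets. Then any two vertices in the same part have Hamming distance
`|N(u) △ N(u')| < 2n/(3ℓ-1)`. -/
theorem same_part_hamming_close {V : Type*} [Fintype V] [DecidableEq V] (ℓ : ℕ)
    (hℓ : 2 ≤ ℓ) (α : ℝ) (hα : (3 * (ℓ : ℝ) - 4) / (3 * (ℓ : ℝ) - 1) < α)
    (G : SimpleGraph V) [DecidableRel G.Adj]
    (hn : 1 ≤ Fintype.card V)
    (hdeg : α * (Fintype.card V : ℝ) ≤ (G.minDegree : ℝ))
    (U : Fin ℓ → Finset V)
    (hdisj : ∀ i j : Fin ℓ, i ≠ j → Disjoint (U i) (U j))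
    (hcover : ∀ v : V, ∃ i : Fin ℓ, v ∈ U i)
    (hind : ∀ i : Fin ℓ, ∀ u ∈ U i, ∀ v ∈ U i, ¬ G.Adj u v) :
    ∀ i : Fin ℓ, ∀ u ∈ U i, ∀ u' ∈ U i,
      ((symmDiff (G.neighborFinset u) (G.neighborFinset u')).card : ℝ)
        < 2 * (Fintype.card V : ℝ) / (3 * (ℓ : ℝ) - 1) := by
  intro i u hu u' hu'
  have hℓ' : (2 : ℝ) ≤ ℓ := by exact_mod_cast hℓ
  have hn' : (1 : ℝ) ≤ Fintype.card V := by exact_mod_cast hn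
  have hpos : 0 < 3 * (ℓ : ℝ) - 1 := by linarith
  obtain ⟨t, ht⟩ : ∃ t : ℝ, t = (Fintype.card V : ℝ) / (3 * (ℓ : ℝ) - 1) := ⟨_, rfl⟩
  have hnt : (Fintype.card V : ℝ) = (3 * (ℓ : ℝ) - 1) * t := by rw [ht]; field_simp
  have ht0 : 0 < t := by rw [ht]; positivity
  have hδ : (Fintype.card V : ℝ) - 3 * t < G.minDegree := by
    have h := mul_lt_mul_of_pos_right hα (show (0 : ℝ) < Fintype.card V by linarith)
    have h' : (3 * (ℓ : ℝ) - 4) / (3 * (ℓ : ℝ) - 1) * (Fintype.card V : ℝ)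
        = Fintype.card V - 3 * t := by
      rw [ht]; field_simp; ring
    linarith
  have hpart : ∀ j, ((U j).card : ℝ) ≤ 3 * t := by
    intro j
    obtain h | ⟨v, hv⟩ := (U j).eq_empty_or_nonempty
    · rw [h, Finset.card_empty, Nat.cast_zero]; positivity
    · have h1 := card_add_degree_add_card_sdiff_le G (U j) (hind j) hv hv
      have h2 : ((U j).card : ℝ) + G.minDegree ≤ Fintype.card V := by
        have h3 := G.minDegree_le_degree v
        exact_mod_cast (by omega : (U j).card + G.minDegree ≤ Fintype.card V)
      linarith
  have hU : 2 * t ≤ (U i).card := by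
    have h1 : Fintype.card V ≤ ∑ j, (U j).card := by
      have h : (Finset.univ : Finset V) = Finset.univ.biUnion U := by
        ext v; simpa using hcover v
      rw [← Finset.card_univ, h]
      exact Finset.card_biUnion_le
    have h2 : (Fintype.card V : ℝ) ≤ ∑ j, ((U j).card : ℝ) := by exact_mod_cast h1
    rw [← Finset.add_sum_erase _ _ (Finset.mem_univ i)] at h2
    have h3 := Finset.sum_le_card_nsmul (Finset.univ.erase i) (fun j => ((U j).card : ℝ))
      (3 * t) (fun j _ => hpart j)
    rw [Finset.card_erase_of_mem (Finset.mem_univ i), Finset.card_univ, Fintype.card_fin,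
      nsmul_eq_mul, Nat.cast_sub (by omega), Nat.cast_one] at h3
    nlinarith
  have hsdiff : ∀ v ∈ U i, ∀ w ∈ U i,
      ((G.neighborFinset v \ G.neighborFinset w).card : ℝ) < t := by
    intro v hv w hw
    have h1 : ((U i).card : ℝ) + G.degree w
        + (G.neighborFinset v \ G.neighborFinset w).card ≤ Fintype.card V := by
      exact_mod_cast card_add_degree_add_card_sdiff_le G (U i) (hind i) hv hw
    have h2 : (G.minDegree : ℝ) ≤ G.degree w := by exact_mod_cast G.minDegree_le_degree w
    linarith
  have hle : ((symmDiff (G.neighborFinset u) (G.neighborFinset u')).card : ℝ)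
      ≤ (G.neighborFinset u \ G.neighborFinset u').card
        + (G.neighborFinset u' \ G.neighborFinset u).card := by
    exact_mod_cast Finset.card_union_le _ _
  rw [mul_div_assoc, ← ht]
  linarith [hsdiff u hu u' hu', hsdiff u' hu' u hu]
end

section
/- Let n ≥ ℓ ≥ 2 and k ≥ 0 be integers with n ≥ max{6ℓ², 30kℓ}. Then every K_{ℓ+1}-free graph G on n vertices with at least ex(n, K_{ℓ+1}) − k edges is ℓ-partite. -/
/-- The Turán number `ex(n, K_{ℓ+1})`: the maximum number of edges of an
`n`-vertex `K_{ℓ+1}`-free simple graph. -/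
noncomputable def turanNumber (n ℓ : ℕ) : ℕ :=
  sSup {m : ℕ | ∃ G : SimpleGraph (Fin n), G.CliqueFree (ℓ + 1) ∧ G.edgeSet.ncard = m}

open Finset in
/-- A graph that is close to complete multipartite with large parts, and has an edge inside
part `0`, contains a large clique. -/
lemma not_cliqueFree_of_card_missing_lt {V : Type*} [Fintype V] [DecidableEq V]
    (G : SimpleGraph V) [DecidableRel G.Adj] {m : ℕ} (c : V → Fin (m + 1)) {x y : V}
    (hx : c x = 0) (hy : c y = 0) (hxy : G.Adj x y) {P : ℕ}
    (hmissing : #{q : V × V | c q.2 ≠ 0 ∧ c q.1 ≠ c q.2 ∧ ¬ G.Adj q.1 q.2} < P)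
    (hparts : ∀ i, P ≤ #{v | c v = i}) : ¬ G.CliqueFree (m + 2) := by
  have hemb : ∀ i : Fin (m + 1), ∃ f : Fin P ↪ V, ∀ j, c (f j) = i := by
    intro i
    obtain ⟨T, hT, hTcard⟩ := exists_subset_card_eq (hparts i)
    refine ⟨((T.equivFinOfCardEq hTcard).symm.toEmbedding).trans (.subtype _), fun j => ?_⟩
    have := hT ((T.equivFinOfCardEq hTcard).symm j).2
    simpa using this
  choose f hf using hemb
  have hgood : ∃ j, ∀ u (i : Fin m), c u ≠ i.succ → G.Adj u (f i.succ j) := by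
    by_contra! hbad
    choose u i hne hnadj using hbad
    refine hmissing.not_ge ?_
    have hinj : Function.Injective fun j => (u j, f (i j).succ j) := by
      intro j j' h
      simp only [Prod.mk.injEq] at h
      have hi : (i j).succ = (i j').succ := by rw [← hf (i j).succ j, h.2, hf]
      have h2 := h.2
      rw [hi] at h2
      exact (f _).injective h2
    calc P = #(univ.image fun j => (u j, f (i j).succ j)) := by
          rw [card_image_of_injective _ hinj, card_fin]
      _ ≤ _ := by
          refine card_le_card fun q hq => ?_
          obtain ⟨j, -, rfl⟩ := mem_image.1 hq
          simp [hf, hne, hnadj]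
  obtain ⟨j, hj⟩ := hgood
  have hinj : Function.Injective fun i : Fin m => f i.succ j := by
    intro i i' h
    have := congrArg c h
    simpa [hf] using this
  have hclique : G.IsNClique m (univ.image fun i : Fin m => f i.succ j) := by
    refine ⟨?_, by rw [card_image_of_injective _ hinj, card_fin]⟩
    intro a ha b hb hab
    simp only [coe_image, coe_univ, Set.image_univ, Set.mem_range] at ha hb
    obtain ⟨i, rfl⟩ := ha
    obtain ⟨i', rfl⟩ := hb
    refine hj _ _ ?_
    rw [hf]
    rintro h
    exact hab (by rw [Fin.succ_injective _ h])
  have hclique' := hclique.insert (a := y) (by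
    simp only [mem_image, mem_univ, true_and, forall_exists_index, forall_apply_eq_imp_iff]
    exact fun i => hj _ _ (by rw [hy]; exact (Fin.succ_ne_zero i).symm))
  refine (hclique'.insert (a := x) ?_).not_cliqueFree
  simp only [mem_insert, mem_image, mem_univ, true_and, forall_eq_or_imp, forall_exists_index,
    forall_apply_eq_imp_iff]
  exact ⟨hxy, fun i => hj _ _ (by rw [hx]; exact (Fin.succ_ne_zero i).symm)⟩

open Finset in
/-- Moving a unit from a large part to a small one decreases the sum of the squares of the parts.
Hence the parts of a nearly optimal partition are not small. -/
lemma lt_part_of_nearly_minimal_sum_sq {ℓ k : ℕ} (p : Fin ℓ → ℕ)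
    (hcard : ℓ * (3 * k + 2) ≤ ∑ i, p i)
    (hmin : ∀ p' : Fin ℓ → ℕ, ∑ i, p' i = ∑ i, p i → ∑ i, p i ^ 2 ≤ ∑ i, p' i ^ 2 + 2 * k)
    (i : Fin ℓ) : 2 * k < p i := by
  by_contra! hi
  obtain ⟨j, -, hj⟩ : ∃ j ∈ univ, 3 * k + 2 ≤ p j := by
    refine exists_le_of_sum_le ⟨i, mem_univ i⟩ ?_
    simpa using hcard
  have hij : i ≠ j := by rintro rfl; omega
  have hjmem : j ∈ univ.erase i := by simp [hij.symm]
  have hsplit (g : Fin ℓ → ℕ) :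
      ∑ l, g l = g i + (g j + ∑ l ∈ (univ.erase i).erase j, g l) := by
    rw [add_sum_erase _ _ hjmem, add_sum_erase _ _ (mem_univ i)]
  let p' : Fin ℓ → ℕ := fun l => if l = i then p i + 1 else if l = j then p j - 1 else p l
  have hp'i : p' i = p i + 1 := by simp [p']
  have hp'j : p' j = p j - 1 := by simp [p', hij.symm]
  have hp'l : ∀ l ∈ (univ.erase i).erase j, p' l = p l := by
    intro l hl
    simp only [mem_erase, mem_univ, and_true] at hl
    simp [p', hl.1, hl.2]
  have hsum : ∑ l ∈ (univ.erase i).erase j, p' l = ∑ l ∈ (univ.erase i).erase j, p l :=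
    sum_congr rfl hp'l
  have hsum_sq : ∑ l ∈ (univ.erase i).erase j, p' l ^ 2 =
      ∑ l ∈ (univ.erase i).erase j, p l ^ 2 :=
    sum_congr rfl fun l hl => by rw [hp'l l hl]
  have h := hmin p' (by rw [hsplit p', hsplit p, hp'i, hp'j, hsum]; omega)
  rw [hsplit fun l => p l ^ 2, hsplit fun l => p' l ^ 2, hsum_sq, hp'i, hp'j] at h
  obtain ⟨r, hr⟩ := Nat.exists_eq_add_of_le' (show 1 ≤ p j by omega)
  rw [hr, Nat.add_sub_cancel] at h
  nlinarith

open Finset in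
lemma exists_partition_sum_sq_le {n ℓ s : ℕ} (h : (ℓ + 1) * s ≤ n) :
    ∃ p : Fin (ℓ + 1) → ℕ, ∑ i, p i = n ∧ ∑ i, p i ^ 2 ≤ n * (n - ℓ * s) := by
  have h' : s + ℓ * s ≤ n := by linarith
  have hsum : ∑ i, (Fin.cons (n - ℓ * s) fun _ => s : Fin (ℓ + 1) → ℕ) i = n := by
    rw [Fin.sum_cons]
    simp only [sum_const, card_univ, Fintype.card_fin, smul_eq_mul]
    omega
  refine ⟨_, hsum, ?_⟩
  conv_rhs => rw [← hsum, sum_mul, hsum]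
  refine sum_le_sum fun i _ => ?_
  rw [sq]
  refine Nat.mul_le_mul_left _ ?_
  refine Fin.cases ?_ (fun i => ?_) i
  · simp
  · simp only [Fin.cons_succ]
    omega

open Finset in
lemma sum_sq_card_fiber {V α : Type*} [Fintype V] [Fintype α] [DecidableEq α] (c : V → α) :
    ∑ i, #{v | c v = i} ^ 2 = ∑ u, ∑ w, if c u = c w then 1 else 0 := by
  have h (u : V) : (∑ w, if c u = c w then 1 else 0) =
      ∑ i, if c u = i then #{v | c v = i} else 0 := by
    simp [eq_comm]
  simp_rw [h]
  rw [sum_comm]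
  refine sum_congr rfl fun i _ => ?_
  rw [← sum_filter, sum_const, smul_eq_mul, sq]

open Finset in
lemma SimpleGraph.degree_eq_sum_ite {V : Type*} [Fintype V] (G : SimpleGraph V)
    [DecidableRel G.Adj] (u : V) : G.degree u = ∑ w, if G.Adj u w then 1 else 0 := by
  rw [← G.card_neighborFinset_eq_degree, G.neighborFinset_eq_filter, card_filter]

open Finset in
lemma sq_le_turanNumber_add_sum_sq {n ℓ : ℕ} (p : Fin ℓ → ℕ) (hp : ∑ i, p i = n) :
    n ^ 2 ≤ 2 * turanNumber n ℓ + ∑ i, p i ^ 2 := by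
  classical
  let e : (Σ i, Fin (p i)) ≃ Fin n := Fintype.equivFinOfCardEq (by simp [hp])
  let c : Fin n → Fin ℓ := fun v => (e.symm v).1
  have hc (i : Fin ℓ) : #{v | c v = i} = p i := by
    rw [← Fintype.card_subtype, ← Fintype.card_fin (p i)]
    exact Fintype.card_congr ((e.symm.subtypeEquiv fun v => Iff.rfl).trans
      (Equiv.sigmaSubtype (β := fun i => Fin (p i)) i))
  let M : SimpleGraph (Fin n) := SimpleGraph.comap c ⊤
  have hM : M.edgeFinset.card ≤ turanNumber n ℓ := by
    refine le_csSup ?_ ⟨M, ?_, ?_⟩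
    · exact ((Set.finite_range fun G : SimpleGraph (Fin n) => G.edgeSet.ncard).subset
        (by rintro _ ⟨G, -, rfl⟩; exact ⟨G, rfl⟩)).bddAbove
    · have hcol : M.Colorable ℓ := ⟨SimpleGraph.Coloring.mk c fun h => h⟩
      exact hcol.cliqueFree (Nat.lt_succ_self ℓ)
    · rw [← SimpleGraph.coe_edgeFinset, Set.ncard_coe_finset]
  have hcount : 2 * M.edgeFinset.card + ∑ i, p i ^ 2 = n ^ 2 := by
    rw [← M.sum_degrees_eq_twice_card_edges]
    simp_rw [← hc, M.degree_eq_sum_ite]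
    rw [sum_sq_card_fiber, ← sum_add_distrib]
    simp_rw [← sum_add_distrib]
    calc _ = ∑ u : Fin n, ∑ w : Fin n, 1 := by
          refine sum_congr rfl fun u _ => sum_congr rfl fun w _ => ?_
          by_cases h : c u = c w <;> simp [M, h]
      _ = _ := by simp [sq]
  omega

open Finset in
/-- If `G` has, up to `k`, at least as many edges as every complete `(m + 1)`-partite graph on
`V`, then being `K_{m + 2}`-free forces `G` to be `(m + 1)`-partite. -/
lemma SimpleGraph.CliqueFree.colorable_of_sq_card_le (k m : ℕ) :
    ∀ {V : Type*} [Fintype V] (G : SimpleGraph V) [DecidableRel G.Adj], G.CliqueFree (m + 2) →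
      (m + 1) * (3 * k + 2) ≤ Fintype.card V →
      (∀ p : Fin (m + 1) → ℕ, ∑ i, p i = Fintype.card V →
        Fintype.card V ^ 2 ≤ ∑ u, G.degree u + 2 * k + ∑ i, p i ^ 2) →
      G.Colorable (m + 1) := by
  classical
  induction m with
  | zero =>
    intro V _ G _ hfree _ _
    rw [SimpleGraph.cliqueFree_two.1 hfree]
    exact ⟨SimpleGraph.Coloring.mk (fun _ => 0) fun h => h.elim⟩
  | succ m ih =>
    intro V _ G _ hfree hcard hedges
    set n := Fintype.card V
    have hnpos : 2 * k < n := by nlinarith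
    have : Nonempty V := Fintype.card_pos_iff.1 (by omega)
    obtain ⟨v, hv⟩ := G.exists_maximal_degree_vertex
    set d := G.degree v
    have hmax (u : V) : G.degree u ≤ d := hv ▸ G.degree_le_maxDegree u
    have hdn : d < n := G.degree_lt_card_verts v
    let S := G.neighborFinset v
    let A (X Y : Finset V) : ℕ := ∑ u ∈ X, ∑ w ∈ Y, if G.Adj u w then 1 else 0
    have hS : #S = d := G.card_neighborFinset_eq_degree v
    have hSc : #Sᶜ = n - d := by rw [card_compl, hS]
    have hdegree (u : V) : G.degree u = (∑ w ∈ S, if G.Adj u w then 1 else 0) +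
        ∑ w ∈ Sᶜ, if G.Adj u w then 1 else 0 := by
      rw [G.degree_eq_sum_ite, sum_add_sum_compl]
    have hA (X : Finset V) : ∑ u ∈ X, G.degree u = A X S + A X Sᶜ := by
      simp only [A, ← sum_add_distrib, hdegree]
    have hcomm : A S Sᶜ = A Sᶜ S := by
      simp only [A]
      rw [sum_comm]
      simp_rw [G.adj_comm]
    have hdegrees : ∑ u, G.degree u = A S S + 2 * A Sᶜ S + A Sᶜ Sᶜ := by
      rw [← sum_add_sum_compl S, hA, hA, hcomm]
      ring
    have houtside : A Sᶜ S + A Sᶜ Sᶜ ≤ (n - d) * d := by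
      rw [← hA, ← hSc]
      exact sum_le_card_nsmul _ _ _ fun u _ => hmax u
    have hd_large : (m + 1) * (3 * k + 2) ≤ d := by
      obtain ⟨p, hp, hp2⟩ := exists_partition_sum_sq_le hcard
      have h1 := hedges p hp
      have h2 : ∑ u, G.degree u ≤ n * d := by
        simpa using sum_le_card_nsmul univ _ _ fun u _ => hmax u
      obtain ⟨r, hr⟩ := Nat.exists_eq_add_of_le
        (show (m + 1) * (3 * k + 2) ≤ n by nlinarith)
      have hr' : n - (m + 1) * (3 * k + 2) = r := by omega
      rw [hr'] at hp2
      by_contra! hlt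
      nlinarith
    have hH : (G.induce (S : Set V)).Colorable (m + 1) := by
      have hcardH : Fintype.card (S : Set V) = d := by simpa using hS
      refine ih _ ?_ (hcardH ▸ hd_large) fun p hp => ?_
      · intro t ht
        have hclique :=
          ht.map (f := (SimpleGraph.Embedding.induce (G := G) (S : Set V)).toEmbedding)
        have hclique' := (hclique.mono (SimpleGraph.map_comap_le _ G)).insert (a := v) (by
          intro b hb
          obtain ⟨w, -, rfl⟩ := mem_map.1 hb
          exact (G.mem_neighborFinset v _).1 w.2)
        exact hfree _ hclique'
      · rw [hcardH] at hp ⊢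
        have h1 := hedges (Fin.cons (n - d) p) (by rw [Fin.sum_cons, hp]; omega)
        rw [Fin.sum_univ_succ] at h1
        simp only [Fin.cons_zero, Fin.cons_succ] at h1
        have h2 : ∑ u, (G.induce (S : Set V)).degree u = A S S := by
          simp_rw [SimpleGraph.degree_eq_sum_ite]
          simp only [A, SimpleGraph.comap_adj, Function.Embedding.subtype_apply]
          rw [← sum_coe_sort S]
          refine sum_congr rfl fun u _ => ?_
          rw [← sum_coe_sort S]
          rfl
        rw [h2]
        obtain ⟨r, hr⟩ := Nat.exists_eq_add_of_le hdn.le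
        have hr' : n - d = r := by omega
        rw [hr'] at h1 houtside
        rw [hdegrees, hr] at h1
        nlinarith
    obtain ⟨C⟩ := hH
    let c : V → Fin (m + 1 + 1) := fun u => if h : u ∈ S then (C ⟨u, h⟩).succ else 0
    have hc_zero (u : V) : c u = 0 ↔ u ∉ S := by
      by_cases h : u ∈ S <;> simp [c, h, Fin.succ_ne_zero]
    have hc_valid {u w : V} (hu : u ∈ S) (hw : w ∈ S) (h : G.Adj u w) : c u ≠ c w := by
      simp only [c, hu, hw, dif_pos]
      intro heq
      have hadj : (G.induce (S : Set V)).Adj ⟨u, hu⟩ ⟨w, hw⟩ := h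
      exact C.valid hadj (Fin.succ_injective _ heq)
    let p : Fin (m + 1 + 1) → ℕ := fun i => #{u | c u = i}
    have hp : ∑ i, p i = n :=
      (card_eq_sum_card_fiberwise (f := c) (s := univ) (t := univ) (by simp)).symm
    let e : ℕ := ∑ u ∈ S, ∑ w ∈ S, if c u = c w then 1 else 0
    have hp_sq : ∑ i, p i ^ 2 = e + (n - d) ^ 2 := by
      simp only [p]
      rw [sum_sq_card_fiber, ← sum_add_sum_compl S]
      congr 1
      · refine sum_congr rfl fun u hu => ?_
        rw [← sum_add_sum_compl S, Nat.add_eq_left]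
        refine sum_eq_zero fun w hw => if_neg fun h => ?_
        rw [(hc_zero w).2 (mem_compl.1 hw)] at h
        exact (hc_zero u).1 h hu
      · rw [sq, ← hSc, ← smul_eq_mul, ← sum_const]
        refine sum_congr rfl fun u hu => ?_
        rw [← card_filter]
        congr 1
        ext w
        rw [(hc_zero u).2 (mem_compl.1 hu)]
        simp only [mem_filter, mem_univ, true_and, mem_compl, ← hc_zero]
        exact eq_comm
    let B (X : Finset V) : ℕ := ∑ u ∈ X, ∑ w ∈ S, if c u ≠ c w ∧ ¬ G.Adj u w then 1 else 0
    have hmissing : #{q : V × V | c q.2 ≠ 0 ∧ c q.1 ≠ c q.2 ∧ ¬ G.Adj q.1 q.2} = B S + B Sᶜ := by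
      rw [card_filter, Fintype.sum_prod_type, sum_add_sum_compl]
      refine sum_congr rfl fun u _ => ?_
      rw [← sum_subset (subset_univ S) fun w _ hw => if_neg fun h => h.1 ((hc_zero w).2 hw)]
      refine sum_congr rfl fun w hw => ?_
      have hw' : c w ≠ 0 := fun h => (hc_zero w).1 h hw
      simp [hw']
    have hB_inside : B S + A S S + e = d ^ 2 := by
      simp only [B, A, e, ← sum_add_distrib]
      calc _ = ∑ u ∈ S, ∑ w ∈ S, 1 := by
            refine sum_congr rfl fun u hu => sum_congr rfl fun w hw => ?_
            have := @hc_valid u w hu hw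
            by_cases h : c u = c w <;> by_cases h' : G.Adj u w <;> simp_all
        _ = _ := by simp [hS, sq]
    have hB_outside : B Sᶜ + A Sᶜ S = (n - d) * d := by
      simp only [B, A, ← sum_add_distrib]
      calc _ = ∑ u ∈ Sᶜ, ∑ w ∈ S, 1 := by
            refine sum_congr rfl fun u hu => sum_congr rfl fun w hw => ?_
            have hne : c u ≠ c w := by
              rw [(hc_zero u).2 (mem_compl.1 hu)]
              exact fun h => (hc_zero w).1 h.symm hw
            by_cases h' : G.Adj u w <;> simp [hne, h']
        _ = _ := by simp only [sum_const, smul_eq_mul, mul_one, hS, hSc]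
    have hn_sq : n ^ 2 = d ^ 2 + 2 * ((n - d) * d) + (n - d) ^ 2 := by
      obtain ⟨r, hr⟩ := Nat.exists_eq_add_of_le hdn.le
      rw [show n - d = r by omega, hr]
      ring
    by_contra hnot
    obtain ⟨x, y, hxy, hcxy⟩ : ∃ x y, G.Adj x y ∧ c x = c y := by
      by_contra! h
      exact hnot ⟨SimpleGraph.Coloring.mk c fun hadj => h _ _ hadj⟩
    have hx : c x = 0 := by
      by_contra hx
      have hy : c y ≠ 0 := hcxy ▸ hx
      rw [Ne, hc_zero, not_not] at hy
      rw [hc_zero, not_not] at hx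
      exact hc_valid hx hy hxy hcxy
    refine not_cliqueFree_of_card_missing_lt G c hx (hcxy ▸ hx) hxy (P := 2 * k + 1) ?_ ?_ hfree
    · have := hedges p hp
      rw [hmissing, Nat.lt_succ_iff]
      linarith
    · refine lt_part_of_nearly_minimal_sum_sq p (by rw [hp]; exact hcard) fun p' hp' => ?_
      have h1 := hedges p' (hp'.trans hp)
      have h2 : ∑ u, G.degree u + ∑ i, p i ^ 2 ≤ n ^ 2 := by linarith
      linarith

/-- Let `n ≥ ℓ ≥ 2` and `k ≥ 0` with `n ≥ max {6ℓ², 30kℓ}`. Then every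
`K_{ℓ+1}`-free graph `G` on `n` vertices with at least `ex(n, K_{ℓ+1}) - k`
edges is `ℓ`-partite. -/
theorem cliqueFree_nearTuran_colorable {V : Type*} [Fintype V] (n ℓ k : ℕ)
    (hℓ : 2 ≤ ℓ) (hn : ℓ ≤ n) (h1 : 6 * ℓ ^ 2 ≤ n) (h2 : 30 * k * ℓ ≤ n)
    (G : SimpleGraph V) [DecidableRel G.Adj] (hcard : Fintype.card V = n)
    (hfree : G.CliqueFree (ℓ + 1))
    (hedges : turanNumber n ℓ ≤ G.edgeFinset.card + k) :
    G.Colorable ℓ := by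
  obtain ⟨m, rfl⟩ := Nat.exists_eq_add_of_le' (show 1 ≤ ℓ by omega)
  refine SimpleGraph.CliqueFree.colorable_of_sq_card_le k m G hfree ?_ fun p hp => ?_
  · rw [hcard]
    rcases Nat.eq_zero_or_pos k with rfl | hk <;> nlinarith
  · have := sq_le_turanNumber_add_sum_sq p hp
    rw [G.sum_degrees_eq_twice_card_edges]
    rw [hcard] at this ⊢
    omega
end

section
/- Let ℓ ≥ 2, n ≥ 1 and k ≥ 0 be integers. Every n-vertex K_{ℓ+1}-free graph G with at least ex(n, K_{ℓ+1}) − k edges satisfies δ(G) ≥ n − ⌈n/ℓ⌉ − k. -/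
open SimpleGraph in
/-- Adding one vertex to the Turán graph on `n` vertices adds `n - n / r` edges. -/
theorem card_edgeFinset_turanGraph_succ (n r : ℕ) (hr : 0 < r) :
    (turanGraph (n + 1) r).edgeFinset.card + n / r = (turanGraph n r).edgeFinset.card + n := by
  induction n using Nat.strong_induction_on with
  | _ n ih =>
    rcases lt_or_ge n r with h | h
    · have key (m : ℕ) (hm : m ≤ r) : (turanGraph m r).edgeFinset.card = m.choose 2 := by
        have htop := card_edgeFinset_top_eq_card_choose_two (V := Fin m)
        rw [Fintype.card_fin] at htop
        convert htop
        exact turanGraph_eq_top.2 (Or.inr hm)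
      rw [key _ h, key _ h.le, Nat.div_eq_of_lt h, Nat.choose_succ_succ' n 1]
      simp [add_comm]
    · obtain ⟨m, rfl⟩ := Nat.exists_eq_add_of_le' h
      have h₁ := ih m (by omega)
      have h₂ := card_edgeFinset_turanGraph_add (n := m) (r := r)
      have h₃ := card_edgeFinset_turanGraph_add (n := m + 1) (r := r)
      rw [add_right_comm] at h₃
      rw [h₂, h₃, Nat.add_div_right _ hr, Nat.succ_mul]
      omega

open SimpleGraph in
theorem card_edgeFinset_turanGraph_le_turanNumber (n ℓ : ℕ) (hℓ : 0 < ℓ) :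
    (turanGraph n ℓ).edgeFinset.card ≤ turanNumber n ℓ := by
  refine le_csSup ⟨n.choose 2, ?_⟩ ⟨turanGraph n ℓ, turanGraph_cliqueFree hℓ, ?_⟩
  · rintro m ⟨G, -, rfl⟩
    classical
    rw [← coe_edgeFinset, Set.ncard_coe_finset]
    simpa using G.card_edgeFinset_le_card_choose_two
  · rw [← coe_edgeFinset, Set.ncard_coe_finset]

/-- Let `ℓ ≥ 2`, `n ≥ 1`, `k ≥ 0`. Every `n`-vertex `K_{ℓ+1}`-free graph `G`
with at least `ex(n, K_{ℓ+1}) - k` edges satisfies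
`δ(G) ≥ n - ⌈n/ℓ⌉ - k`. -/
theorem minDegree_of_nearTuran {V : Type*} [Fintype V] (n ℓ k : ℕ)
    (hℓ : 2 ≤ ℓ) (hn : 1 ≤ n)
    (G : SimpleGraph V) [DecidableRel G.Adj] (hcard : Fintype.card V = n)
    (hfree : G.CliqueFree (ℓ + 1))
    (hedges : turanNumber n ℓ ≤ G.edgeFinset.card + k) :
    (n : ℝ) - ((⌈(n : ℝ) / (ℓ : ℝ)⌉ : ℤ) : ℝ) - (k : ℝ) ≤ (G.minDegree : ℝ) := by
  classical
  obtain ⟨m, rfl⟩ := Nat.exists_eq_add_of_le' hn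
  have hℓ₀ : 0 < ℓ := by omega
  have : Nonempty V := Fintype.card_pos_iff.1 (by omega)
  obtain ⟨v, hv⟩ := G.exists_minimal_degree_vertex
  have h₁ := card_edgeFinset_turanGraph_le_turanNumber (m + 1) ℓ hℓ₀
  have h₂ := card_edgeFinset_turanGraph_succ m ℓ hℓ₀
  have h₃ := SimpleGraph.card_edgeFinset_deleteIncidenceSet_le_extremalNumber
    (SimpleGraph.cliqueFree_iff_top_free (β := Fin (ℓ + 1)).1 (by simpa using hfree)) v
  have : Nontrivial (Fin (ℓ + 1)) := Fin.nontrivial_iff_two_le.2 (by omega)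
  rw [hcard, Nat.add_sub_cancel, SimpleGraph.extremalNumber_top,
    SimpleGraph.card_edgeFinset_deleteIncidenceSet, Fintype.card_fin,
    Nat.add_sub_cancel] at h₃
  have h₄ : m ≤ m / ℓ + k + G.minDegree := by omega
  have h₅ : ((m / ℓ : ℕ) : ℤ) < ⌈((m + 1 : ℕ) : ℝ) / (ℓ : ℝ)⌉ := by
    rw [Int.lt_ceil, lt_div_iff₀ (by positivity)]
    exact_mod_cast Nat.lt_succ_of_le (Nat.div_mul_le_self m ℓ)
  have h₆ : ((m / ℓ : ℕ) : ℝ) + 1 ≤ ((⌈((m + 1 : ℕ) : ℝ) / (ℓ : ℝ)⌉ : ℤ) : ℝ) := by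
    simpa only [Int.cast_add, Int.cast_natCast, Int.cast_one] using
      (Int.cast_le (R := ℝ)).2 (Int.add_one_le_of_lt h₅)
  have h₇ : (m : ℝ) ≤ (m / ℓ : ℕ) + k + G.minDegree := by exact_mod_cast h₄
  push_cast at h₆ ⊢
  linarith
end

section
/- For all integers ℓ ≥ 2 and n ≥ 0, writing s = n − ℓ·⌊n/ℓ⌋, the Turán number satisfies ex(n, K_{ℓ+1}) = ((ℓ−1)/(2ℓ))·n² − (s/2)·(1 − s/ℓ); in particular, ex(n, K_{ℓ+1}) ≥ ((ℓ−1)/(2ℓ))·n² − ℓ/8. -/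
/-- The number of edges of the Turán graph `turanGraph n r`, as a real number. -/
theorem SimpleGraph.cast_card_edgeFinset_turanGraph (n r : ℕ) (hr : 0 < r) :
    ((turanGraph n r).edgeFinset.card : ℝ) =
      ((r : ℝ) - 1) / (2 * r) * (n : ℝ) ^ 2
        - (((n % r : ℕ) : ℝ) / 2) * (1 - ((n % r : ℕ) : ℝ) / r) := by
  have hdvd : 2 * r ∣ (n ^ 2 - (n % r) ^ 2) * (r - 1) := by
    obtain ⟨k, hk⟩ := (Nat.even_mul_pred_self r).two_dvd
    have hsq : n ^ 2 - (n % r) ^ 2 = r * (n / r) * (r * (n / r) + 2 * (n % r)) := by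
      nth_rw 1 [← Nat.mod_add_div n r]
      rw [Nat.sub_eq_of_eq_add]
      ring
    refine ⟨k * (n / r) ^ 2 + (n / r) * (n % r) * (r - 1), ?_⟩
    rw [hsq]
    linear_combination r * (n / r) ^ 2 * hk
  have hle : (n % r) ^ 2 ≤ n ^ 2 := Nat.pow_le_pow_left (Nat.mod_le n r) 2
  have hr0 : (r : ℝ) ≠ 0 := by positivity
  rw [card_edgeFinset_turanGraph, Nat.cast_add, Nat.cast_div hdvd (by positivity),
    Nat.cast_choose_two, Nat.cast_mul, Nat.cast_sub hle, Nat.cast_pred hr]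
  push_cast
  field_simp
  ring

/-- **Turán's theorem**: the Turán number is the number of edges of the Turán graph. -/
theorem turanNumber_eq_card_edgeFinset_turanGraph (n r : ℕ) (hr : 0 < r) :
    turanNumber n r = (SimpleGraph.turanGraph n r).edgeFinset.card := by
  classical
  refine IsGreatest.csSup_eq ⟨⟨SimpleGraph.turanGraph n r,
    SimpleGraph.turanGraph_cliqueFree hr, ?_⟩, ?_⟩
  · rw [← SimpleGraph.coe_edgeFinset, Set.ncard_coe_finset]
  · rintro m ⟨G, hG, rfl⟩
    rw [← SimpleGraph.coe_edgeFinset, Set.ncard_coe_finset]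
    exact (SimpleGraph.isTuranMaximal_turanGraph hr).2 hG

/-- For all integers `ℓ ≥ 2` and `n ≥ 0`, writing `s = n - ℓ⌊n/ℓ⌋`, one has
`ex(n, K_{ℓ+1}) = ((ℓ-1)/(2ℓ)) n² - (s/2)(1 - s/ℓ)`; in particular
`ex(n, K_{ℓ+1}) ≥ ((ℓ-1)/(2ℓ)) n² - ℓ/8`. -/
theorem turanNumber_formula (ℓ n : ℕ) (hℓ : 2 ≤ ℓ) :
    ∀ s : ℕ, s = n - ℓ * (n / ℓ) →
      (turanNumber n ℓ : ℝ)
          = ((ℓ : ℝ) - 1) / (2 * (ℓ : ℝ)) * (n : ℝ) ^ 2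
            - ((s : ℝ) / 2) * (1 - (s : ℝ) / (ℓ : ℝ)) ∧
      ((ℓ : ℝ) - 1) / (2 * (ℓ : ℝ)) * (n : ℝ) ^ 2 - (ℓ : ℝ) / 8
          ≤ (turanNumber n ℓ : ℝ) := by
  rintro s rfl
  have hr : 0 < ℓ := by positivity
  have hmod : n - ℓ * (n / ℓ) = n % ℓ := by
    have := Nat.mod_add_div n ℓ
    omega
  have hℓ0 : (0 : ℝ) < ℓ := by exact_mod_cast hr
  rw [hmod, turanNumber_eq_card_edgeFinset_turanGraph n ℓ hr,
    SimpleGraph.cast_card_edgeFinset_turanGraph n ℓ hr]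
  refine ⟨rfl, sub_le_sub_left ?_ _⟩
  generalize ((n % ℓ : ℕ) : ℝ) = s
  have key : (ℓ : ℝ) / 8 - s / 2 * (1 - s / ℓ) = (ℓ - 2 * s) ^ 2 / (8 * ℓ) := by
    field_simp
    ring
  have : (0 : ℝ) ≤ (ℓ - 2 * s) ^ 2 / (8 * ℓ) := by positivity
  linarith
end

section
/- Let P = (ℓ, E) be an r-pattern and let H be an r-graph on n ≥ 1 vertices. If there exists a homomorphism from H to P, then δ(H) ≤ r·λ_P·n^{r−1}. -/
open Finset

/-- An `r`-pattern: a positive integer `numV` (the vertex count) together with a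
collection of `r`-element multisets on its vertex set. -/
structure Pattern (r : ℕ) where
  numV : ℕ
  pos : 0 < numV
  E : Finset (Multiset (Fin numV))
  card_eq : ∀ e ∈ E, Multiset.card e = r

/-- The Lagrange polynomial `Λ_P(x) = Σ_{e ∈ E} Π_i x_i^{e(i)} / e(i)!`. -/
noncomputable def Pattern.lagrangePoly {r : ℕ} (P : Pattern r)
    (x : Fin P.numV → ℝ) : ℝ :=
  ∑ e ∈ P.E, ∏ i : Fin P.numV, x i ^ (e.count i) / ((e.count i).factorial : ℝ)

/-- The standard simplex `Δ^{ℓ-1}`. -/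
def simplexOn (ℓ : ℕ) : Set (Fin ℓ → ℝ) :=
  {x | (∀ i, 0 ≤ x i) ∧ ∑ i, x i = 1}

/-- The Lagrangian `λ_P = max { Λ_P(x) : x ∈ Δ^{ℓ-1} }`. -/
noncomputable def Pattern.lagrangian {r : ℕ} (P : Pattern r) : ℝ :=
  sSup (P.lagrangePoly '' simplexOn P.numV)

/-- The degree of a vertex `v` in an `r`-graph `H`. -/
def hdeg {V : Type*} [DecidableEq V] (H : Finset (Finset V)) (v : V) : ℕ :=
  (H.filter (fun e => v ∈ e)).card

/-- The minimum degree of an `r`-graph `H` on the (finite) vertex type `V`. -/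
noncomputable def hMinDeg {V : Type*} [DecidableEq V] (H : Finset (Finset V)) : ℕ :=
  sInf (Set.range (fun v : V => hdeg H v))

/-- At most `∏ i, (c i).choose (e.count i)` sets are mapped by `φ` onto the multiset `e`, where
`c i` is the size of the fibre of `φ` over `i`. -/
theorem card_filter_map_eq_le_prod_choose {V ι : Type*} [Fintype V] [DecidableEq V] [Fintype ι]
    [DecidableEq ι] (φ : V → ι) (H : Finset (Finset V)) (e : Multiset ι) :
    #{S ∈ H | Multiset.map φ S.val = e} ≤ ∏ i, (#{v | φ v = i}).choose (e.count i) := by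
  calc #{S ∈ H | Multiset.map φ S.val = e}
      ≤ #(Fintype.piFinset fun i => powersetCard (e.count i) {v | φ v = i}) := by
        refine card_le_card_of_injOn (fun S i => {v ∈ S | φ v = i}) ?_ ?_
        · intro S hS
          obtain ⟨-, rfl⟩ := mem_filter.1 (mem_coe.1 hS)
          refine mem_coe.2 (Fintype.mem_piFinset.2 fun i => mem_powersetCard.2 ⟨?_, ?_⟩)
          · exact filter_subset_filter _ (subset_univ S)
          · simp only [Multiset.count_map, card_def, filter_val, eq_comm]
        · intro S _ T _ hST
          ext v
          simpa using congrArg (v ∈ ·) (congrFun hST (φ v))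
    _ = ∏ i, (#{v | φ v = i}).choose (e.count i) := by
        simp only [Fintype.card_piFinset, card_powersetCard]

theorem Pattern.lagrangePoly_smul {r : ℕ} (P : Pattern r) (t : ℝ) (x : Fin P.numV → ℝ) :
    P.lagrangePoly (t • x) = t ^ r * P.lagrangePoly x := by
  unfold Pattern.lagrangePoly
  rw [mul_sum]
  refine sum_congr rfl fun e he => ?_
  have hsum : ∑ i, e.count i = r := by
    rw [Multiset.sum_count_eq_card fun a _ => mem_univ a, P.card_eq e he]
  simp only [Pi.smul_apply, smul_eq_mul, mul_pow, mul_div_assoc, prod_mul_distrib,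
    prod_pow_eq_pow_sum, hsum]

theorem Pattern.lagrangePoly_le_lagrangian {r : ℕ} (P : Pattern r) {x : Fin P.numV → ℝ}
    (hx : x ∈ simplexOn P.numV) : P.lagrangePoly x ≤ P.lagrangian := by
  have hcont : Continuous P.lagrangePoly := by
    unfold Pattern.lagrangePoly
    fun_prop
  exact le_csSup ((isCompact_stdSimplex ℝ (Fin P.numV)).image hcont).bddAbove
    (Set.mem_image_of_mem _ hx)

/-- An `r`-graph with a homomorphism to `P` has at most `Λ_P(c)` edges, where `c` is the vector of
fibre sizes. -/
theorem card_le_lagrangePoly_of_hom {V : Type*} [Fintype V] [DecidableEq V] {r : ℕ}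
    (P : Pattern r) (H : Finset (Finset V)) (φ : V → Fin P.numV)
    (hφ : ∀ e ∈ H, Multiset.map φ e.val ∈ P.E) :
    (#H : ℝ) ≤ P.lagrangePoly fun i => (#{v | φ v = i} : ℝ) := by
  rw [card_eq_sum_card_fiberwise (f := fun S : Finset V => Multiset.map φ S.val) hφ, Nat.cast_sum]
  refine sum_le_sum fun e _ => ?_
  calc (#{S ∈ H | Multiset.map φ S.val = e} : ℝ)
      ≤ ∏ i, ((#{v | φ v = i}).choose (e.count i) : ℝ) := by
        exact_mod_cast card_filter_map_eq_le_prod_choose φ H e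
    _ ≤ _ := prod_le_prod (fun _ _ => Nat.cast_nonneg _) fun i _ => Nat.choose_le_pow_div _ _

theorem card_le_lagrangian_mul_pow_of_hom {V : Type*} [Fintype V] [DecidableEq V] {r : ℕ}
    (P : Pattern r) (H : Finset (Finset V)) (hn : 1 ≤ Fintype.card V)
    (φ : V → Fin P.numV) (hφ : ∀ e ∈ H, Multiset.map φ e.val ∈ P.E) :
    (#H : ℝ) ≤ P.lagrangian * (Fintype.card V : ℝ) ^ r := by
  have hn0 : (Fintype.card V : ℝ) ≠ 0 := by positivity
  set c : Fin P.numV → ℝ := fun i => (#{v | φ v = i} : ℝ) with hc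
  have hsum : ∑ i, c i = Fintype.card V := by
    have h := card_eq_sum_card_fiberwise (f := φ) (s := univ) (t := univ) (by simp)
    rw [card_univ] at h
    rw [h, Nat.cast_sum]
  have hmem : (Fintype.card V : ℝ)⁻¹ • c ∈ simplexOn P.numV := by
    refine ⟨fun i => ?_, ?_⟩
    · simp only [Pi.smul_apply, smul_eq_mul, hc]
      positivity
    · simp only [Pi.smul_apply, smul_eq_mul, ← mul_sum, hsum]
      exact inv_mul_cancel₀ hn0
  calc (#H : ℝ) ≤ P.lagrangePoly c := card_le_lagrangePoly_of_hom P H φ hφ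
    _ = (Fintype.card V : ℝ) ^ r * P.lagrangePoly ((Fintype.card V : ℝ)⁻¹ • c) := by
        rw [← P.lagrangePoly_smul, smul_inv_smul₀ hn0]
    _ ≤ (Fintype.card V : ℝ) ^ r * P.lagrangian := by
        gcongr
        exact P.lagrangePoly_le_lagrangian hmem
    _ = _ := mul_comm _ _

theorem card_mul_hMinDeg_le {V : Type*} [Fintype V] [DecidableEq V] {r : ℕ}
    (H : Finset (Finset V)) (hcard : ∀ e ∈ H, #e = r) :
    Fintype.card V * hMinDeg H ≤ r * #H := by
  calc Fintype.card V * hMinDeg H = ∑ _v : V, hMinDeg H := by simp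
    _ ≤ ∑ v, hdeg H v := sum_le_sum fun v _ => Nat.sInf_le ⟨v, rfl⟩
    _ = ∑ e ∈ H, #e := by
        simpa [bipartiteAbove, bipartiteBelow, hdeg] using
          sum_card_bipartiteAbove_eq_sum_card_bipartiteBelow (s := univ) (t := H)
            (fun (v : V) (e : Finset V) => v ∈ e)
    _ = r * #H := by rw [sum_congr rfl hcard, sum_const, smul_eq_mul, mul_comm]

/-- If an `r`-graph `H` on `n ≥ 1` vertices admits a homomorphism to an
`r`-pattern `P`, then `δ(H) ≤ r λ_P n^{r-1}`. -/
theorem minDegree_le_of_hom {V : Type*} [Fintype V] [DecidableEq V] (r : ℕ)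
    (P : Pattern r) (H : Finset (Finset V)) (hcard : ∀ e ∈ H, e.card = r)
    (hn : 1 ≤ Fintype.card V)
    (φ : V → Fin P.numV) (hφ : ∀ e ∈ H, Multiset.map φ e.val ∈ P.E) :
    (hMinDeg H : ℝ) ≤ (r : ℝ) * P.lagrangian * (Fintype.card V : ℝ) ^ (r - 1) := by
  have hpos : (0 : ℝ) < Fintype.card V := by exact_mod_cast hn
  have hdouble : (Fintype.card V : ℝ) * hMinDeg H ≤ r * #H := by
    exact_mod_cast card_mul_hMinDeg_le H hcard
  have hedges := card_le_lagrangian_mul_pow_of_hom P H hn φ hφ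
  refine le_of_mul_le_mul_left ?_ hpos
  rcases r with _ | k
  · simpa using hdouble
  · calc (Fintype.card V : ℝ) * hMinDeg H ≤ (k + 1 : ℕ) * #H := hdouble
      _ ≤ (k + 1 : ℕ) * (P.lagrangian * (Fintype.card V : ℝ) ^ (k + 1)) := by gcongr
      _ = _ := by
        rw [Nat.add_sub_cancel]
        ring
end

section
/- Let P = (ℓ, E) be an r-pattern, let H be an r-graph on n ≥ 1 vertices, and let φ be a homomorphism from H to P. For i ∈ [ℓ] set y_i = |φ^{-1}(i)|/n. Then for every vertex v of H, d_H(v) ≤ ∂_{φ(v)}Λ_P(y_1, …, y_ℓ)·n^{r−1}. -/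
open Finset

/-- The partial derivative `∂_i Λ_P` of the Lagrange polynomial with respect to
the `i`-th variable, evaluated at `x`. -/
noncomputable def Pattern.pderiv {r : ℕ} (P : Pattern r) (i : Fin P.numV)
    (x : Fin P.numV → ℝ) : ℝ :=
  deriv (fun t : ℝ => P.lagrangePoly (Function.update x i t)) (x i)

/-- A vertex set whose colour multiset under `φ` is `e` is determined by its parts in the colour
classes of `φ`, so there are at most `∏ i, |φ⁻¹(i)| ^ e(i) / e(i)!` of them. -/
theorem card_filter_map_eq_le {V ι : Type*} [Fintype V] [DecidableEq V] [Fintype ι]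
    [DecidableEq ι] (φ : V → ι) (e : Multiset ι) :
    ((univ.filter fun A : Finset V => Multiset.map φ A.val = e).card : ℝ) ≤
      ∏ i, ((univ.filter fun v => φ v = i).card : ℝ) ^ e.count i / ((e.count i).factorial : ℝ) := by
  have hle : (univ.filter fun A : Finset V => Multiset.map φ A.val = e).card ≤
      (Fintype.piFinset fun i => powersetCard (e.count i) (univ.filter fun v => φ v = i)).card := by
    refine card_le_card_of_injOn (fun A i => A.filter fun v => φ v = i) ?_ ?_
    · intro A hA
      obtain rfl := (mem_filter.mp hA).2
      simp only [mem_coe, Fintype.mem_piFinset, mem_powersetCard]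
      intro i
      refine ⟨filter_subset_filter _ (subset_univ A), ?_⟩
      simp only [Multiset.count_map, eq_comm (a := i)]
      rfl
    · intro A _ B _ hAB
      ext v
      have := congrArg (v ∈ ·) (congrFun hAB (φ v))
      simpa using this
  calc _ ≤ ((∏ i, (univ.filter fun v => φ v = i).card.choose (e.count i) : ℕ) : ℝ) := by
        simpa [Fintype.card_piFinset] using (Nat.cast_le (α := ℝ)).mpr hle
    _ ≤ _ := by
        push_cast
        exact prod_le_prod (fun _ _ => by positivity) fun _ _ => Nat.choose_le_pow_div _ _

theorem hasDerivAt_pow_div_factorial (k : ℕ) (x : ℝ) :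
    HasDerivAt (fun t : ℝ => t ^ (k + 1) / ((k + 1).factorial : ℝ)) (x ^ k / (k.factorial : ℝ)) x := by
  refine ((hasDerivAt_pow (k + 1) x).div_const ((k + 1).factorial : ℝ)).congr_deriv ?_
  rw [Nat.factorial_succ, Nat.add_sub_cancel]
  push_cast
  field_simp

theorem hasDerivAt_prod_update_pow_div_factorial {ι : Type*} [Fintype ι] [DecidableEq ι]
    (e : Multiset ι) (j : ι) (x : ι → ℝ) :
    HasDerivAt
      (fun t : ℝ => ∏ i, Function.update x j t i ^ e.count i / ((e.count i).factorial : ℝ))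
      (if j ∈ e then ∏ i, x i ^ (e.erase j).count i / (((e.erase j).count i).factorial : ℝ) else 0)
      (x j) := by
  have hsplit (t : ℝ) :
      ∏ i, Function.update x j t i ^ e.count i / ((e.count i).factorial : ℝ) =
        t ^ e.count j / ((e.count j).factorial : ℝ) *
          ∏ i ∈ univ.erase j, x i ^ e.count i / ((e.count i).factorial : ℝ) := by
    rw [← mul_prod_erase univ _ (mem_univ j), Function.update_self]
    congr 1
    exact prod_congr rfl fun i hi => by rw [Function.update_of_ne (ne_of_mem_erase hi)]
  simp only [hsplit]
  split_ifs with hj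
  · obtain ⟨s, rfl⟩ := Multiset.exists_cons_of_mem hj
    rw [← mul_prod_erase univ _ (mem_univ j)]
    simp only [Multiset.erase_cons_head, Multiset.count_cons_self]
    have hrest : ∏ i ∈ univ.erase j, x i ^ s.count i / ((s.count i).factorial : ℝ) =
        ∏ i ∈ univ.erase j, x i ^ (j ::ₘ s).count i / (((j ::ₘ s).count i).factorial : ℝ) :=
      prod_congr rfl fun i hi => by rw [Multiset.count_cons_of_ne (ne_of_mem_erase hi)]
    rw [hrest]
    exact (hasDerivAt_pow_div_factorial _ _).mul_const _
  · simp only [Multiset.count_eq_zero_of_notMem hj, pow_zero]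
    exact hasDerivAt_const _ _

theorem Pattern.pderiv_eq_sum {r : ℕ} (P : Pattern r) (j : Fin P.numV) (x : Fin P.numV → ℝ) :
    P.pderiv j x = ∑ e ∈ P.E, if j ∈ e then
      ∏ i, x i ^ (e.erase j).count i / (((e.erase j).count i).factorial : ℝ) else 0 :=
  (HasDerivAt.fun_sum fun e _ => hasDerivAt_prod_update_pow_div_factorial e j x).deriv

theorem prod_div_pow_div_factorial_mul_pow_card {ι : Type*} [Fintype ι] [DecidableEq ι]
    (e : Multiset ι) (a : ι → ℝ) {n : ℝ} (hn : n ≠ 0) :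
    (∏ i, (a i / n) ^ e.count i / ((e.count i).factorial : ℝ)) * n ^ Multiset.card e =
      ∏ i, a i ^ e.count i / ((e.count i).factorial : ℝ) := by
  rw [← Multiset.sum_count_eq_card (s := univ) (m := e) fun i _ => mem_univ i,
    ← prod_pow_eq_pow_sum, ← prod_mul_distrib]
  refine prod_congr rfl fun i _ => ?_
  rw [div_pow]
  field_simp

/-- Deleting `v` bounds the number of edges through `v` with colour multiset `e`. -/
theorem card_filter_mem_map_eq_le {V ι : Type*} [Fintype V] [DecidableEq V]
    [DecidableEq ι] (H : Finset (Finset V)) (φ : V → ι) (v : V) (e : Multiset ι) :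
    ((H.filter fun A => v ∈ A).filter fun A => Multiset.map φ A.val = e).card ≤
      (univ.filter fun A : Finset V => Multiset.map φ A.val = e.erase (φ v)).card := by
  refine card_le_card_of_injOn (fun A => A.erase v) ?_ ?_
  · intro A hA
    simp only [coe_filter, mem_filter, Set.mem_ofPred_eq] at hA
    obtain ⟨⟨-, hv⟩, rfl⟩ := hA
    simp [Multiset.map_erase_of_mem φ A.val hv]
  · intro A hA B hB hAB
    simp only [coe_filter, mem_filter, Set.mem_ofPred_eq] at hA hB
    rw [← insert_erase hA.1.2, ← insert_erase hB.1.2]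
    exact congrArg (insert v) hAB

/-- Let `φ` be a homomorphism from an `r`-graph `H` on `n ≥ 1` vertices to an
`r`-pattern `P`, and let `y i = |φ⁻¹(i)|/n`. Then for every vertex `v`,
`d_H(v) ≤ ∂_{φ(v)} Λ_P(y) · n^{r-1}`. -/
theorem degree_le_pderiv_of_hom {V : Type*} [Fintype V] [DecidableEq V] (r : ℕ)
    (P : Pattern r) (H : Finset (Finset V)) (hcard : ∀ e ∈ H, e.card = r)
    (hn : 1 ≤ Fintype.card V)
    (φ : V → Fin P.numV) (hφ : ∀ e ∈ H, Multiset.map φ e.val ∈ P.E)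
    (y : Fin P.numV → ℝ)
    (hy : ∀ i, y i = ((Finset.univ.filter (fun v : V => φ v = i)).card : ℝ)
      / (Fintype.card V : ℝ)) :
    ∀ v : V, (hdeg H v : ℝ)
      ≤ P.pderiv (φ v) y * (Fintype.card V : ℝ) ^ (r - 1) := by
  intro v
  have hn0 : (Fintype.card V : ℝ) ≠ 0 := by positivity
  have hdeg_eq : hdeg H v = ∑ e ∈ P.E,
      ((H.filter fun A => v ∈ A).filter fun A => Multiset.map φ A.val = e).card :=
    card_eq_sum_card_fiberwise fun A hA => hφ A (mem_filter.mp hA).1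
  rw [hdeg_eq, P.pderiv_eq_sum, sum_mul, Nat.cast_sum]
  refine sum_le_sum fun e he => ?_
  split_ifs with hv
  · have hcard_erase : Multiset.card (e.erase (φ v)) = r - 1 := by
      rw [Multiset.card_erase_of_mem hv, P.card_eq e he, Nat.pred_eq_sub_one]
    simp only [hy]
    rw [← hcard_erase, prod_div_pow_div_factorial_mul_pow_card _ _ hn0]
    exact (Nat.cast_le.mpr (card_filter_mem_map_eq_le H φ v e)).trans (card_filter_map_eq_le φ _)
  · rw [zero_mul, Nat.cast_nonpos, card_eq_zero, filter_eq_empty_iff]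
    rintro A hA rfl
    exact hv (Multiset.mem_map_of_mem φ (mem_filter.mp hA).2)
end

section
/- Every minimal r-pattern P is rigid; moreover, for every minimal r-pattern P one has r·λ_P = Φ_P. -/
open Finset

/-- `P` is minimal if deleting any vertex `i` strictly decreases the
Lagrangian; since edges containing `i` evaluate to zero whenever `x i = 0`,
the Lagrangian of `P - i` equals the maximum of `Λ_P` over the face
`{x ∈ Δ^{ℓ-1} : x i = 0}` of the simplex. -/
def Pattern.IsMinimal {r : ℕ} (P : Pattern r) : Prop :=
  ∀ i : Fin P.numV,
    sSup (P.lagrangePoly '' {x ∈ simplexOn P.numV | x i = 0}) < P.lagrangian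

/-- `Φ_P`: the maximum `z` such that some `x ∈ Δ^{ℓ-1}` has
`∂_i Λ_P(x) ≥ z` for all `i`. -/
noncomputable def Pattern.Phi {r : ℕ} (P : Pattern r) : ℝ :=
  sSup {z : ℝ | ∃ x ∈ simplexOn P.numV, ∀ i : Fin P.numV, z ≤ P.pderiv i x}

/-- `D_P`: the set of optimal solutions of the optimization problem
defining `Φ_P`. -/
noncomputable def Pattern.D {r : ℕ} (P : Pattern r) : Set (Fin P.numV → ℝ) :=
  {x ∈ simplexOn P.numV | ∀ i : Fin P.numV, P.Phi ≤ P.pderiv i x}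

/-- `φ_P = min_{x ∈ D_P} min_i x_i`. -/
noncomputable def Pattern.phi {r : ℕ} (P : Pattern r) : ℝ :=
  sInf {y : ℝ | ∃ x ∈ P.D, ∃ i : Fin P.numV, x i = y}

/-- `P` is rigid if `φ_P > 0` and `∂_i Λ_P(x) = Φ_P` for all `i` and all
`x ∈ D_P`. -/
def Pattern.IsRigid {r : ℕ} (P : Pattern r) : Prop :=
  0 < P.phi ∧ ∀ x ∈ P.D, ∀ i : Fin P.numV, P.pderiv i x = P.Phi

theorem isCompact_simplexOn (ℓ : ℕ) : IsCompact (simplexOn ℓ) :=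
  isCompact_stdSimplex ℝ (Fin ℓ)

theorem simplexOn_nonempty {ℓ : ℕ} (hℓ : 0 < ℓ) : (simplexOn ℓ).Nonempty :=
  ⟨Pi.single ⟨0, hℓ⟩ 1, single_mem_stdSimplex ℝ _⟩

namespace Pattern

variable {r : ℕ} (P : Pattern r)

theorem contDiff_lagrangePoly : ContDiff ℝ 1 P.lagrangePoly := by
  unfold lagrangePoly
  fun_prop

theorem lagrangePoly_smul_s14 (t : ℝ) (x : Fin P.numV → ℝ) :
    P.lagrangePoly (t • x) = t ^ r * P.lagrangePoly x := by
  unfold lagrangePoly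
  rw [mul_sum]
  refine sum_congr rfl fun e he => ?_
  have hr : ∑ i, e.count i = r :=
    (Multiset.sum_count_eq_card fun i _ => mem_univ i).trans (P.card_eq e he)
  have ht : t ^ r = ∏ i, t ^ e.count i := by
    rw [prod_pow_eq_pow_sum]
    exact congrArg (t ^ ·) hr.symm
  rw [ht, ← prod_mul_distrib]
  refine prod_congr rfl fun i _ => ?_
  rw [Pi.smul_apply, smul_eq_mul, mul_pow, mul_div_assoc]

theorem hasDerivAt_lagrangePoly_update (i : Fin P.numV) (x : Fin P.numV → ℝ) :
    HasDerivAt (fun t : ℝ => P.lagrangePoly (Function.update x i t))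
      (fderiv ℝ P.lagrangePoly x (Pi.single i 1)) (x i) := by
  have h : HasFDerivAt P.lagrangePoly (fderiv ℝ P.lagrangePoly x)
      (Function.update x i (x i)) := by
    rw [Function.update_eq_self]
    exact (P.contDiff_lagrangePoly.differentiable one_ne_zero x).hasFDerivAt
  exact h.comp_hasDerivAt (x i) (hasDerivAt_update x i (x i))

theorem pderiv_eq_fderiv (i : Fin P.numV) (x : Fin P.numV → ℝ) :
    P.pderiv i x = fderiv ℝ P.lagrangePoly x (Pi.single i 1) :=
  (P.hasDerivAt_lagrangePoly_update i x).deriv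

theorem continuous_pderiv (i : Fin P.numV) : Continuous (P.pderiv i) := by
  have h : P.pderiv i = fun x => fderiv ℝ P.lagrangePoly x (Pi.single i 1) :=
    funext (P.pderiv_eq_fderiv i)
  rw [h]
  exact (P.contDiff_lagrangePoly.continuous_fderiv one_ne_zero).clm_apply continuous_const

/-- Euler identity for the homogeneous polynomial `Λ_P`. -/
theorem sum_mul_pderiv (x : Fin P.numV → ℝ) :
    ∑ i, x i * P.pderiv i x = r * P.lagrangePoly x := by
  have hsum : ∑ i, x i * P.pderiv i x = fderiv ℝ P.lagrangePoly x x := by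
    conv_rhs => enter [2]; rw [pi_eq_sum_univ' x]
    rw [map_sum]
    refine sum_congr rfl fun i _ => ?_
    rw [P.pderiv_eq_fderiv, map_smul, smul_eq_mul]
  have hline : HasDerivAt (fun t : ℝ => t • x) x 1 := by
    simpa using (hasDerivAt_id (1 : ℝ)).smul_const x
  have hfd : HasFDerivAt P.lagrangePoly (fderiv ℝ P.lagrangePoly x) ((1 : ℝ) • x) := by
    rw [one_smul]
    exact (P.contDiff_lagrangePoly.differentiable one_ne_zero x).hasFDerivAt
  have h₁ := hfd.comp_hasDerivAt (1 : ℝ) hline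
  have h₂ : HasDerivAt (fun t : ℝ => t ^ r * P.lagrangePoly x) (r * P.lagrangePoly x) 1 := by
    simpa using (hasDerivAt_pow r (1 : ℝ)).mul_const (P.lagrangePoly x)
  have heq : P.lagrangePoly ∘ (fun t : ℝ => t • x) = fun t : ℝ => t ^ r * P.lagrangePoly x :=
    funext fun t => P.lagrangePoly_smul_s14 t x
  rw [heq] at h₁
  rw [hsum, h₁.unique h₂]

theorem isCompact_image_simplexOn : IsCompact (P.lagrangePoly '' simplexOn P.numV) :=
  (isCompact_simplexOn _).image P.contDiff_lagrangePoly.continuous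

theorem lagrangePoly_le_lagrangian_s14 {x : Fin P.numV → ℝ} (hx : x ∈ simplexOn P.numV) :
    P.lagrangePoly x ≤ P.lagrangian :=
  le_csSup P.isCompact_image_simplexOn.bddAbove ⟨x, hx, rfl⟩

theorem exists_lagrangePoly_eq_lagrangian :
    ∃ x ∈ simplexOn P.numV, P.lagrangePoly x = P.lagrangian :=
  P.isCompact_image_simplexOn.sSup_mem ((simplexOn_nonempty P.pos).image _)

theorem lagrangePoly_le_lagrangian_mul_pow {y : Fin P.numV → ℝ} (hy : ∀ i, 0 ≤ y i)
    (hpos : 0 < ∑ i, y i) : P.lagrangePoly y ≤ P.lagrangian * (∑ i, y i) ^ r := by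
  set s := ∑ i, y i with hs
  have hmem : s⁻¹ • y ∈ simplexOn P.numV := by
    refine ⟨fun i => mul_nonneg (inv_nonneg.2 hpos.le) (hy i), ?_⟩
    simp only [Pi.smul_apply, smul_eq_mul, ← mul_sum, ← hs]
    exact inv_mul_cancel₀ hpos.ne'
  have hy' : y = s • (s⁻¹ • y) := (smul_inv_smul₀ hpos.ne' y).symm
  rw [hy', P.lagrangePoly_smul_s14, mul_comm]
  exact mul_le_mul_of_nonneg_right (P.lagrangePoly_le_lagrangian_s14 hmem) (by positivity)

/-- At a maximizer of `Λ_P` on the simplex, the partial derivative in any direction with a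
positive coordinate equals `r λ_P`. -/
theorem pderiv_eq_of_lagrangePoly_eq_lagrangian {x : Fin P.numV → ℝ}
    (hx : x ∈ simplexOn P.numV) (hmax : P.lagrangePoly x = P.lagrangian) {i : Fin P.numV}
    (hi : 0 < x i) : P.pderiv i x = r * P.lagrangian := by
  have hsum (t : ℝ) : ∑ j, Function.update x i t j = 1 + (t - x i) := by
    rw [sum_update_of_mem (mem_univ i), ← hx.2, ← add_sum_erase univ x (mem_univ i),
      sdiff_singleton_eq_erase]
    ring
  have hloc : IsLocalMax (fun t : ℝ => P.lagrangePoly (Function.update x i t) -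
      P.lagrangian * (1 + (t - x i)) ^ r) (x i) := by
    have hle : x i ≤ 1 := hx.2 ▸ single_le_sum (fun j _ => hx.1 j) (mem_univ i)
    filter_upwards [lt_mem_nhds hi] with t ht
    have hnonneg (j : Fin P.numV) : 0 ≤ Function.update x i t j := by
      rcases eq_or_ne j i with rfl | hj
      · simpa using ht.le
      · simpa [hj] using hx.1 j
    have hbound := P.lagrangePoly_le_lagrangian_mul_pow hnonneg (by rw [hsum]; linarith)
    rw [hsum] at hbound
    simp only [Function.update_eq_self, sub_self, add_zero, one_pow, mul_one, hmax]
    linarith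
  have hpow : HasDerivAt (fun t : ℝ => P.lagrangian * (1 + (t - x i)) ^ r)
      (r * P.lagrangian) (x i) := by
    have h := ((((hasDerivAt_id (x i)).sub_const (x i)).const_add 1).pow r).const_mul P.lagrangian
    simpa [mul_comm] using h
  have hzero := hloc.hasDerivAt_eq_zero ((P.hasDerivAt_lagrangePoly_update i x).sub hpow)
  rw [P.pderiv_eq_fderiv]
  linarith

theorem le_mul_lagrangePoly {x : Fin P.numV → ℝ} (hx : x ∈ simplexOn P.numV) {z : ℝ}
    (hz : ∀ i, z ≤ P.pderiv i x) : z ≤ r * P.lagrangePoly x := by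
  rw [← P.sum_mul_pderiv]
  calc z = ∑ i, x i * z := by rw [← sum_mul, hx.2, one_mul]
    _ ≤ _ := sum_le_sum fun i _ => mul_le_mul_of_nonneg_left (hz i) (hx.1 i)

theorem isCompact_D : IsCompact P.D := by
  refine (isCompact_simplexOn P.numV).inter_right (t := {x | ∀ i, P.Phi ≤ P.pderiv i x}) ?_
  simp only [Set.ofPred_forall]
  exact isClosed_iInter fun i => isClosed_le continuous_const (P.continuous_pderiv i)

variable {P}

theorem IsMinimal.pos_of_lagrangePoly_eq_lagrangian (h : P.IsMinimal) {x : Fin P.numV → ℝ}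
    (hx : x ∈ simplexOn P.numV) (hmax : P.lagrangePoly x = P.lagrangian) (i : Fin P.numV) :
    0 < x i := by
  refine (hx.1 i).lt_of_ne' fun h0 => (h i).not_ge ?_
  rw [← hmax]
  exact le_csSup (P.isCompact_image_simplexOn.bddAbove.mono
    (Set.image_mono fun _ hy => hy.1)) ⟨x, ⟨hx, h0⟩, rfl⟩

theorem IsMinimal.isGreatest (h : P.IsMinimal) :
    IsGreatest {z : ℝ | ∃ x ∈ simplexOn P.numV, ∀ i : Fin P.numV, z ≤ P.pderiv i x}
      (r * P.lagrangian) := by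
  refine ⟨?_, ?_⟩
  · obtain ⟨x, hx, hmax⟩ := P.exists_lagrangePoly_eq_lagrangian
    exact ⟨x, hx, fun i => (P.pderiv_eq_of_lagrangePoly_eq_lagrangian hx hmax
      (h.pos_of_lagrangePoly_eq_lagrangian hx hmax i)).ge⟩
  · rintro z ⟨x, hx, hz⟩
    exact (P.le_mul_lagrangePoly hx hz).trans
      (mul_le_mul_of_nonneg_left (P.lagrangePoly_le_lagrangian_s14 hx) r.cast_nonneg)

theorem IsMinimal.mul_lagrangian_eq_Phi (h : P.IsMinimal) : r * P.lagrangian = P.Phi :=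
  h.isGreatest.csSup_eq.symm

theorem IsMinimal.D_nonempty (h : P.IsMinimal) : P.D.Nonempty := by
  obtain ⟨x, hx, hz⟩ := h.isGreatest.1
  exact ⟨x, hx, h.mul_lagrangian_eq_Phi ▸ hz⟩

theorem IsMinimal.lagrangePoly_eq_lagrangian (h : P.IsMinimal) {x : Fin P.numV → ℝ}
    (hx : x ∈ P.D) : P.lagrangePoly x = P.lagrangian := by
  rcases Nat.eq_zero_or_pos r with rfl | hr
  · obtain ⟨y, -, hy⟩ := P.exists_lagrangePoly_eq_lagrangian
    have hconst (z : Fin P.numV → ℝ) : P.lagrangePoly z = P.lagrangePoly 0 := by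
      simpa using (P.lagrangePoly_smul_s14 0 z).symm
    rw [← hy, hconst x, hconst y]
  · refine (P.lagrangePoly_le_lagrangian_s14 hx.1).antisymm ?_
    have hle := P.le_mul_lagrangePoly hx.1 hx.2
    rw [← h.mul_lagrangian_eq_Phi] at hle
    exact le_of_mul_le_mul_left hle (Nat.cast_pos.2 hr)

theorem IsMinimal.phi_pos (h : P.IsMinimal) : 0 < P.phi := by
  have hS : {y : ℝ | ∃ x ∈ P.D, ∃ i : Fin P.numV, x i = y} =
      ⋃ i : Fin P.numV, (fun x : Fin P.numV → ℝ => x i) '' P.D := by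
    ext y
    simp only [Set.mem_ofPred_eq, Set.mem_iUnion, Set.mem_image]
    exact ⟨fun ⟨x, hx, i, hi⟩ => ⟨i, x, hx, hi⟩, fun ⟨i, x, hx, hi⟩ => ⟨x, hx, i, hi⟩⟩
  have hcomp : IsCompact {y : ℝ | ∃ x ∈ P.D, ∃ i : Fin P.numV, x i = y} :=
    hS ▸ isCompact_iUnion fun i => P.isCompact_D.image (continuous_apply i)
  obtain ⟨x₀, hx₀⟩ := h.D_nonempty
  obtain ⟨x, hx, i, hi⟩ := hcomp.sInf_mem ⟨_, x₀, hx₀, ⟨0, P.pos⟩, rfl⟩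
  exact (h.pos_of_lagrangePoly_eq_lagrangian hx.1 (h.lagrangePoly_eq_lagrangian hx) i).trans_eq hi

end Pattern

/-- Every minimal `r`-pattern is rigid, and moreover `r λ_P = Φ_P` for every
minimal `r`-pattern `P`. -/
theorem isRigid_of_isMinimal (r : ℕ) (P : Pattern r) (h : P.IsMinimal) :
    P.IsRigid ∧ (r : ℝ) * P.lagrangian = P.Phi := by
  refine ⟨⟨h.phi_pos, fun x hx i => ?_⟩, h.mul_lagrangian_eq_Phi⟩
  have hmax := h.lagrangePoly_eq_lagrangian hx
  rw [← h.mul_lagrangian_eq_Phi]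
  exact P.pderiv_eq_of_lagrangePoly_eq_lagrangian hx.1 hmax
    (h.pos_of_lagrangePoly_eq_lagrangian hx.1 hmax i)
end

section
/- Let P be a rigid r-pattern on ℓ vertices. Then there exist ε > 0 and n₀ such that for every n ≥ n₀ and every r-graph H on n vertices with δ(H) ≥ (Φ_P − ε)·n^{r−1}, any two surjective homomorphisms φ and ψ from H to P satisfy ψ = σ∘φ for some automorphism σ of P; that is, the surjective homomorphism from H to P, if it exists, is unique up to an automorphism of P. -/
open Finset

/-- A homomorphism from an `r`-graph `H` to the `r`-pattern `P` is a map on the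
vertices sending (the vertex multiset of) every edge of `H` into `P.E`. -/
def IsPatternHom {r n : ℕ} (P : Pattern r) (H : Finset (Finset (Fin n)))
    (φ : Fin n → Fin P.numV) : Prop :=
  ∀ e ∈ H, Multiset.map φ e.val ∈ P.E

/-- An automorphism of `P` is a permutation of its vertices preserving the
edge multisets. -/
def IsPatternAut {r : ℕ} (P : Pattern r) (σ : Equiv.Perm (Fin P.numV)) : Prop :=
  ∀ e ∈ P.E, Multiset.map σ e ∈ P.E


theorem Multiset.exists_map_univ_eq_of_card_eq {α : Type*} {m : ℕ} (f : Multiset α)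
    (hf : Multiset.card f = m) : ∃ t : Fin m → α, univ.val.map t = f := by
  subst hf
  induction f using Quotient.inductionOn with
  | h l => exact ⟨l.get, (Fin.univ_val_map l.get).trans (congrArg _ (List.ofFn_get l))⟩

/-- The number of orderings of a multiset, times the product of the factorials of the
multiplicities, is the factorial of its size. -/
theorem card_orderings_mul_prod_factorial {α : Type*} [Fintype α] [DecidableEq α] (m : ℕ)
    (f : Multiset α) (hf : Multiset.card f = m) :
    (univ.filter fun s : Fin m → α => univ.val.map s = f).card *
      ∏ j, (f.count j).factorial = m.factorial := by
  induction m generalizing f with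
  | zero =>
    rw [Multiset.card_eq_zero] at hf
    subst hf
    simp
  | succ m ih =>
    have hcons : ∀ (a : α) (s : Fin m → α),
        (univ : Finset (Fin (m + 1))).val.map (Fin.cons a s : Fin (m + 1) → α)
          = a ::ₘ univ.val.map s := by
      intro a s
      simp [Fin.univ_succ, Function.comp_def]
    have hcard : (univ.filter fun s : Fin (m + 1) → α => univ.val.map s = f).card
        = ∑ a, (univ.filter fun s : Fin m → α => a ::ₘ univ.val.map s = f).card := by
      simp only [Finset.card_filter]
      rw [← (Fin.consEquiv (fun _ : Fin (m + 1) => α)).sum_comp, Fintype.sum_prod_type]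
      refine Finset.sum_congr rfl fun a _ => Finset.sum_congr rfl fun s _ => ?_
      have := hcons a s
      simp only [Fin.consEquiv, Equiv.coe_fn_mk, this]
    rw [hcard, Finset.sum_mul]
    have hterm : ∀ a, (univ.filter fun s : Fin m → α => a ::ₘ univ.val.map s = f).card *
        ∏ j, (f.count j).factorial = f.count a * m.factorial := by
      intro a
      by_cases ha : a ∈ f
      · obtain ⟨g, rfl⟩ := Multiset.exists_cons_of_mem ha
        have hg : Multiset.card g = m := by simpa using hf
        have hprod : ∏ j, ((a ::ₘ g).count j).factorial
            = (g.count a + 1) * ∏ j, (g.count j).factorial := by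
          rw [← Finset.mul_prod_erase univ _ (Finset.mem_univ a),
            ← Finset.mul_prod_erase univ (fun j => (g.count j).factorial) (Finset.mem_univ a),
            Multiset.count_cons_self, Nat.factorial_succ, mul_assoc]
          congr 2
          refine Finset.prod_congr rfl fun j hj => ?_
          rw [Multiset.count_cons_of_ne (Finset.ne_of_mem_erase hj)]
        simp only [Multiset.cons_inj_right]
        rw [hprod, Multiset.count_cons_self, ← ih g hg]
        ring
      · have : (univ.filter fun s : Fin m → α => a ::ₘ univ.val.map s = f) = ∅ := by
          refine Finset.filter_eq_empty_iff.2 fun s _ h => ha ?_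
          rw [← h]
          exact Multiset.mem_cons_self _ _
        rw [this, Finset.card_empty, zero_mul, Multiset.count_eq_zero_of_notMem ha, zero_mul]
    rw [Finset.sum_congr rfl fun a _ => hterm a, ← Finset.sum_mul,
      Multiset.sum_count_eq_card (fun a _ => Finset.mem_univ a), hf, Nat.factorial_succ]

theorem hasDerivAt_prod_update_pow {ℓ : ℕ} (e : Multiset (Fin ℓ)) (i : Fin ℓ) (x : Fin ℓ → ℝ) :
    HasDerivAt
      (fun t : ℝ => ∏ j, Function.update x i t j ^ (e.count j) / ((e.count j).factorial : ℝ))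
      (if i ∈ e then
        ∏ j, x j ^ ((e.erase i).count j) / (((e.erase i).count j).factorial : ℝ) else 0)
      (x i) := by
  have hfun : (fun t : ℝ =>
        ∏ j, Function.update x i t j ^ (e.count j) / ((e.count j).factorial : ℝ))
      = fun t => t ^ (e.count i) * ((1 / ((e.count i).factorial : ℝ)) *
        ∏ j ∈ univ.erase i, x j ^ (e.count j) / ((e.count j).factorial : ℝ)) := by
    funext t
    rw [← Finset.mul_prod_erase univ _ (Finset.mem_univ i), Function.update_self, ← mul_assoc,
      mul_one_div]
    congr 1
    refine Finset.prod_congr rfl fun j hj => ?_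
    rw [Function.update_of_ne (Finset.ne_of_mem_erase hj)]
  rw [hfun]
  refine ((hasDerivAt_pow (e.count i) (x i)).mul_const _).congr_deriv ?_
  by_cases hi : i ∈ e
  · obtain ⟨g, rfl⟩ := Multiset.exists_cons_of_mem hi
    rw [if_pos hi, Multiset.erase_cons_head,
      ← Finset.mul_prod_erase univ (fun j => x j ^ (g.count j) / ((g.count j).factorial : ℝ))
        (Finset.mem_univ i), Multiset.count_cons_self, Nat.factorial_succ, ← mul_assoc]
    congr 1
    · have : ((g.count i : ℝ) + 1) ≠ 0 := by positivity
      push_cast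
      field_simp
    · refine Finset.prod_congr rfl fun j hj => ?_
      rw [Multiset.count_cons_of_ne (Finset.ne_of_mem_erase hj)]
  · simp [hi]

namespace Pattern

variable {r : ℕ} (P : Pattern r)

/-- The `i`-th partial derivative of the Lagrange polynomial as a sum over ordered tuples. -/
theorem factorial_mul_pderiv (i : Fin P.numV) (x : Fin P.numV → ℝ) :
    ((r - 1).factorial : ℝ) * P.pderiv i x =
      ∑ t : Fin (r - 1) → Fin P.numV,
        if i ::ₘ univ.val.map t ∈ P.E then ∏ k, x (t k) else 0 := by
  have hderiv : P.pderiv i x = ∑ e ∈ P.E, if i ∈ e then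
      ∏ j, x j ^ ((e.erase i).count j) / (((e.erase i).count j).factorial : ℝ) else 0 := by
    unfold pderiv lagrangePoly
    exact (HasDerivAt.fun_sum fun e _ => hasDerivAt_prod_update_pow e i x).deriv
  have hsplit : ∀ t : Fin (r - 1) → Fin P.numV,
      (if i ::ₘ univ.val.map t ∈ P.E then ∏ k, x (t k) else 0)
        = ∑ e ∈ P.E, if i ::ₘ univ.val.map t = e then ∏ k, x (t k) else 0 := by
    intro t
    rw [Finset.sum_ite_eq]
  rw [hderiv, Finset.mul_sum, Finset.sum_congr rfl fun t _ => hsplit t, Finset.sum_comm]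
  refine Finset.sum_congr rfl fun e he => ?_
  by_cases hi : i ∈ e
  · obtain ⟨g, rfl⟩ := Multiset.exists_cons_of_mem hi
    have hg : Multiset.card g = r - 1 := by
      have := P.card_eq _ he
      rw [Multiset.card_cons] at this
      omega
    have hterm : ∀ t : Fin (r - 1) → Fin P.numV,
        (if i ::ₘ univ.val.map t = i ::ₘ g then ∏ k, x (t k) else 0)
          = if univ.val.map t = g then ∏ j, x j ^ (g.count j) else 0 := by
      intro t
      simp only [Multiset.cons_inj_right]
      split_ifs with h
      · have hprod : ∏ k, x (t k) = (g.map x).prod := by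
          rw [← h, Multiset.map_map]
          rfl
        rw [hprod, Finset.prod_multiset_map_count]
        refine Finset.prod_subset (Finset.subset_univ _) fun j _ hj => ?_
        rw [Multiset.count_eq_zero_of_notMem (by simpa using hj), pow_zero]
      · rfl
    rw [if_pos hi, Multiset.erase_cons_head, Finset.sum_congr rfl fun t _ => hterm t,
      ← Finset.sum_filter, Finset.sum_const, nsmul_eq_mul, Finset.prod_div_distrib,
      ← card_orderings_mul_prod_factorial _ g hg]
    have : (∏ j, ((g.count j).factorial : ℝ)) ≠ 0 :=
      Finset.prod_ne_zero_iff.2 fun j _ => by positivity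
    push_cast
    field_simp
  · rw [if_neg hi, mul_zero]
    refine (Finset.sum_eq_zero fun t _ => if_neg fun h => hi ?_).symm
    rw [← h]
    exact Multiset.mem_cons_self _ _

end Pattern

namespace Pattern

variable {r : ℕ} (P : Pattern r)

/-- Two vertices are twins if they are interchangeable in the edges of `P`. -/
def Twins (a b : Fin P.numV) : Prop :=
  ∀ f : Multiset (Fin P.numV), a ::ₘ f ∈ P.E ↔ b ::ₘ f ∈ P.E

variable {P}

theorem Twins.map_mem_iff {a b : Fin P.numV} (h : P.Twins a b) (e f : Multiset (Fin P.numV)) :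
    e.map (fun c => if c = b then a else c) + f ∈ P.E ↔ e + f ∈ P.E := by
  induction e using Multiset.induction_on generalizing f with
  | empty => simp
  | cons c e ih =>
    rw [Multiset.map_cons, Multiset.cons_add, ← Multiset.add_cons, ih, Multiset.add_cons,
      Multiset.cons_add]
    split_ifs with hc
    · rw [hc]
      exact h _
    · rfl

theorem D_nonempty_of_phi_pos (h : 0 < P.phi) : P.D.Nonempty := by
  by_contra hD
  rw [Set.not_nonempty_iff_eq_empty] at hD
  simp [phi, hD] at h

theorem phi_le {x : Fin P.numV → ℝ} (hx : x ∈ P.D) (i : Fin P.numV) : P.phi ≤ x i := by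
  refine csInf_le ⟨0, ?_⟩ ⟨x, hx, i, rfl⟩
  rintro _ ⟨y, hy, j, rfl⟩
  exact hy.1.1 j

theorem Twins.eq (h0 : 0 < P.phi) {a b : Fin P.numV} (h : P.Twins a b) : a = b := by
  by_contra hab
  obtain ⟨x, hx, hxD⟩ := D_nonempty_of_phi_pos h0
  set π : Fin P.numV → Fin P.numV := fun c => if c = b then a else c with hπ
  set y : Fin P.numV → ℝ := fun d => ∑ c ∈ univ.filter (fun c => π c = d), x c with hy
  have hyb : y b = 0 := by
    refine Finset.sum_eq_zero fun c hc => absurd (Finset.mem_filter.1 hc).2 ?_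
    simp only [hπ]
    split_ifs with hcb
    · exact hab
    · exact hcb
  have hpderiv : ∀ i, P.pderiv i y = P.pderiv i x := by
    intro i
    have hm : ((r - 1).factorial : ℝ) ≠ 0 := by positivity
    refine mul_left_cancel₀ hm ?_
    rw [factorial_mul_pderiv, factorial_mul_pderiv,
      ← Finset.sum_fiberwise univ (fun t : Fin (r - 1) → Fin P.numV => π ∘ t)
        (fun t => if i ::ₘ univ.val.map t ∈ P.E then ∏ k, x (t k) else 0)]
    refine Finset.sum_congr rfl fun s _ => ?_
    have hfib : univ.filter (fun t : Fin (r - 1) → Fin P.numV => π ∘ t = s)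
        = Fintype.piFinset fun k => univ.filter fun c => π c = s k := by
      ext t
      simp [funext_iff]
    have hmem : ∀ t ∈ univ.filter (fun t : Fin (r - 1) → Fin P.numV => π ∘ t = s),
        (if i ::ₘ univ.val.map t ∈ P.E then ∏ k, x (t k) else 0)
          = if i ::ₘ univ.val.map s ∈ P.E then ∏ k, x (t k) else 0 := by
      intro t ht
      have := h.map_mem_iff (univ.val.map t) (i ::ₘ 0)
      rw [Multiset.map_map, Multiset.add_cons, Multiset.add_cons, add_zero, add_zero] at this
      rw [← (Finset.mem_filter.1 ht).2]
      exact if_congr this.symm rfl rfl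
    rw [Finset.sum_congr rfl hmem, hfib]
    split_ifs
    · exact Finset.prod_univ_sum _ _
    · simp
  have hyD : y ∈ P.D := by
    refine ⟨⟨fun d => Finset.sum_nonneg fun c _ => hx.1 c, ?_⟩, fun i => ?_⟩
    · rw [← hx.2]
      exact Finset.sum_fiberwise univ π x
    · rw [hpderiv]
      exact hxD i
  have := phi_le hyD b
  linarith

/-- Near-optimal points of the simplex have entries bounded away from zero and almost tight
derivatives. -/
theorem IsRigid.exists_stability (hP : P.IsRigid) {c η : ℝ} (hc : c < P.phi) (hη : 0 < η) :
    ∃ ε : ℝ, 0 < ε ∧ ∀ x ∈ simplexOn P.numV, (∀ i, P.Phi - ε ≤ P.pderiv i x) →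
      ∀ i, c < x i ∧ P.pderiv i x < P.Phi + η := by
  set K : Set (Fin P.numV → ℝ) :=
    simplexOn P.numV ∩ ⋃ i, {x | x i ≤ c ∨ P.Phi + η ≤ P.pderiv i x} with hK
  have hsimp : simplexOn P.numV = stdSimplex ℝ (Fin P.numV) := rfl
  have hKc : IsCompact K := by
    refine IsCompact.inter_right (hsimp ▸ isCompact_stdSimplex ℝ _)
      (isClosed_iUnion_of_finite fun i => ?_)
    exact (isClosed_le (continuous_apply i) continuous_const).union
      (isClosed_le continuous_const (P.continuous_pderiv i))
  have hne : (univ : Finset (Fin P.numV)).Nonempty := ⟨⟨0, P.pos⟩, Finset.mem_univ _⟩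
  set F : (Fin P.numV → ℝ) → ℝ := fun x => univ.inf' hne fun i => P.pderiv i x with hF
  have hFc : Continuous F := Continuous.finset_inf'_apply hne fun i _ => P.continuous_pderiv i
  have hlt : ∀ x ∈ K, F x < P.Phi := by
    rintro x ⟨hx, hxK⟩
    by_contra! hle
    have hxD : x ∈ P.D :=
      ⟨hx, fun i => hle.trans (Finset.inf'_le _ (Finset.mem_univ i))⟩
    obtain ⟨i, hi | hi⟩ := Set.mem_iUnion.1 hxK
    · exact absurd (phi_le hxD i) (not_le.2 (lt_of_le_of_lt hi hc))
    · rw [hP.2 x hxD i] at hi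
      linarith
  obtain ⟨M, hM, hFM⟩ : ∃ M < P.Phi, ∀ x ∈ K, F x ≤ M := by
    rcases K.eq_empty_or_nonempty with hKe | hKne
    · exact ⟨P.Phi - 1, by linarith, by simp [hKe]⟩
    · obtain ⟨x, hx, hmax⟩ := hKc.exists_isMaxOn hKne hFc.continuousOn
      exact ⟨F x, hlt x hx, fun y hy => hmax hy⟩
  refine ⟨(P.Phi - M) / 2, by linarith, fun x hx hxε i => ?_⟩
  by_contra hcon
  have hxK : x ∈ K := by
    refine ⟨hx, Set.mem_iUnion.2 ⟨i, ?_⟩⟩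
    rw [not_and_or, not_lt, not_lt] at hcon
    exact hcon
  have h1 := hFM x hxK
  have h2 : P.Phi - (P.Phi - M) / 2 ≤ F x := Finset.le_inf' _ _ fun i _ => hxε i
  linarith

end Pattern

/-- The ordered `(r - 1)`-tuples which together with `v` form an edge of `H`. -/
def linkTuples {n : ℕ} (r : ℕ) (H : Finset (Finset (Fin n))) (v : Fin n) :
    Finset (Fin (r - 1) → Fin n) :=
  univ.filter fun s => ∃ e ∈ H, v ::ₘ univ.val.map s = e.val

theorem factorial_mul_degree_le_card_linkTuples {r n : ℕ} {H : Finset (Finset (Fin n))}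
    (hH : ∀ e ∈ H, e.card = r) (v : Fin n) :
    (r - 1).factorial * (H.filter fun e => v ∈ e).card ≤ (linkTuples r H v).card := by
  have hfib : ∀ e ∈ H.filter (fun e => v ∈ e),
      (univ.filter fun s : Fin (r - 1) → Fin n => v ::ₘ univ.val.map s = e.val).card
        = (r - 1).factorial := by
    intro e he
    obtain ⟨heH, hve⟩ := Finset.mem_filter.1 he
    have hcons : e.val = v ::ₘ (e.erase v).val := by
      rw [Finset.erase_val, Multiset.cons_erase hve]
    have hcard : Multiset.card (e.erase v).val = r - 1 := by
      rw [Finset.card_val, Finset.card_erase_of_mem hve, hH e heH]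
    rw [← card_orderings_mul_prod_factorial (r - 1) _ hcard, Finset.prod_eq_one, mul_one]
    · simp only [hcons, Multiset.cons_inj_right]
    · intro j _
      refine Nat.factorial_eq_one.2 (Multiset.nodup_iff_count_le_one.1 (e.erase v).nodup j)
  have hdisj : Set.PairwiseDisjoint (H.filter fun e => v ∈ e : Set (Finset (Fin n)))
      fun e => univ.filter fun s : Fin (r - 1) → Fin n => v ::ₘ univ.val.map s = e.val := by
    intro e _ e' _ hne
    refine Finset.disjoint_left.2 fun s hs hs' => hne (Finset.val_injective ?_)
    rw [← (Finset.mem_filter.1 hs).2, (Finset.mem_filter.1 hs').2]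
  rw [mul_comm, ← smul_eq_mul, ← Finset.sum_const, ← Finset.sum_congr rfl hfib,
    ← Finset.card_biUnion hdisj]
  refine Finset.card_le_card fun s hs => ?_
  obtain ⟨e, he, hs⟩ := Finset.mem_biUnion.1 hs
  exact Finset.mem_filter.2 ⟨Finset.mem_univ _, e, (Finset.mem_filter.1 he).1,
    (Finset.mem_filter.1 hs).2⟩

/-- The relative sizes of the fibres of `φ`. -/
noncomputable def fiberDensity {n ℓ : ℕ} (φ : Fin n → Fin ℓ) (i : Fin ℓ) : ℝ :=
  ((univ.filter fun v => φ v = i).card : ℝ) / n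

theorem fiberDensity_mem_simplexOn {n ℓ : ℕ} (hn : n ≠ 0) (φ : Fin n → Fin ℓ) :
    fiberDensity φ ∈ simplexOn ℓ := by
  refine ⟨fun i => by unfold fiberDensity; positivity, ?_⟩
  unfold fiberDensity
  rw [← Finset.sum_div, ← Nat.cast_sum,
    ← Finset.card_eq_sum_card_fiberwise fun v _ => Finset.mem_coe.2 (Finset.mem_univ (φ v)),
    Finset.card_univ, Fintype.card_fin]
  exact div_self (Nat.cast_ne_zero.2 hn)

theorem card_comp_eq {n ℓ : ℕ} (hn : n ≠ 0) (φ : Fin n → Fin ℓ) {m : ℕ} (t : Fin m → Fin ℓ) :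
    ((univ.filter fun s : Fin m → Fin n => φ ∘ s = t).card : ℝ)
      = (n : ℝ) ^ m * ∏ k, fiberDensity φ (t k) := by
  have hfib : (univ.filter fun s : Fin m → Fin n => φ ∘ s = t)
      = Fintype.piFinset fun k => univ.filter fun v => φ v = t k := by
    ext s
    simp [funext_iff]
  have hn' : (n : ℝ) ≠ 0 := Nat.cast_ne_zero.2 hn
  unfold fiberDensity
  rw [hfib, Fintype.card_piFinset, Finset.prod_div_distrib, Finset.prod_const, Finset.card_univ,
    Fintype.card_fin, mul_div_cancel₀ _ (pow_ne_zero m hn'), Nat.cast_prod]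

namespace Pattern

variable {r n : ℕ} {P : Pattern r} {H : Finset (Finset (Fin n))} {φ ψ : Fin n → Fin P.numV}

/-- The ordered `(r - 1)`-tuples whose image under `φ` extends `i` to an edge of `P`. -/
def typeTuples (P : Pattern r) (φ : Fin n → Fin P.numV) (i : Fin P.numV) :
    Finset (Fin (r - 1) → Fin n) :=
  univ.filter fun s => i ::ₘ univ.val.map (φ ∘ s) ∈ P.E

theorem card_typeTuples (hn : n ≠ 0) (φ : Fin n → Fin P.numV) (i : Fin P.numV) :
    ((P.typeTuples φ i).card : ℝ)
      = (n : ℝ) ^ (r - 1) * ((r - 1).factorial * P.pderiv i (fiberDensity φ)) := by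
  rw [factorial_mul_pderiv, Finset.mul_sum, typeTuples, Finset.card_filter, Nat.cast_sum,
    ← Finset.sum_fiberwise univ (fun s : Fin (r - 1) → Fin n => φ ∘ s)]
  refine Finset.sum_congr rfl fun t _ => ?_
  have hcongr : ∀ s ∈ univ.filter (fun s : Fin (r - 1) → Fin n => φ ∘ s = t),
      (((if i ::ₘ univ.val.map (φ ∘ s) ∈ P.E then 1 else 0 : ℕ)) : ℝ)
        = if i ::ₘ univ.val.map t ∈ P.E then 1 else 0 := by
    intro s hs
    rw [(Finset.mem_filter.1 hs).2]
    simp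
  rw [Finset.sum_congr rfl hcongr]
  split_ifs
  · rw [Finset.sum_const, nsmul_one, card_comp_eq hn]
  · simp

theorem _root_.IsPatternHom.linkTuples_subset (hφ : IsPatternHom P H φ) (v : Fin n) :
    linkTuples r H v ⊆ P.typeTuples φ (φ v) := by
  intro s hs
  obtain ⟨e, he, hse⟩ := (Finset.mem_filter.1 hs).2
  refine Finset.mem_filter.2 ⟨Finset.mem_univ _, ?_⟩
  have := hφ e he
  rwa [← hse, Multiset.map_cons, Multiset.map_map] at this

/-- A homomorphism is `(c, η)`-dense if all fibres are large and all links are nearly complete. -/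
structure DenseHom (P : Pattern r) (H : Finset (Finset (Fin n))) (φ : Fin n → Fin P.numV)
    (c η : ℝ) : Prop where
  hom : IsPatternHom P H φ
  lt_fiberDensity : ∀ i, c < fiberDensity φ i
  card_sdiff_le : ∀ v, ((P.typeTuples φ (φ v) \ linkTuples r H v).card : ℝ) ≤ η * (n : ℝ) ^ (r - 1)

theorem _root_.IsPatternHom.denseHom {c η ε : ℝ} (hn : n ≠ 0) (hεη : ε ≤ η)
    (hstab : ∀ x ∈ simplexOn P.numV, (∀ i, P.Phi - ε ≤ P.pderiv i x) →
      ∀ i, c < x i ∧ P.pderiv i x < P.Phi + η)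
    (hH : ∀ e ∈ H, e.card = r)
    (hdeg : ∀ v : Fin n, (P.Phi - ε) * (n : ℝ) ^ (r - 1)
      ≤ ((H.filter (fun e => v ∈ e)).card : ℝ))
    (hφ : IsPatternHom P H φ) (hsurj : Function.Surjective φ) :
    P.DenseHom H φ c (2 * (r - 1).factorial * η) := by
  have hpow : 0 < (n : ℝ) ^ (r - 1) := by positivity
  have hfac : 0 < ((r - 1).factorial : ℝ) := by positivity
  have hlink : ∀ v, (r - 1).factorial * ((P.Phi - ε) * (n : ℝ) ^ (r - 1))
      ≤ ((linkTuples r H v).card : ℝ) := by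
    intro v
    refine (mul_le_mul_of_nonneg_left (hdeg v) hfac.le).trans ?_
    exact_mod_cast factorial_mul_degree_le_card_linkTuples hH v
  have hlow : ∀ i, P.Phi - ε ≤ P.pderiv i (fiberDensity φ) := by
    intro i
    obtain ⟨v, rfl⟩ := hsurj i
    have h1 : ((linkTuples r H v).card : ℝ) ≤ (P.typeTuples φ (φ v)).card := by
      exact_mod_cast Finset.card_le_card (hφ.linkTuples_subset v)
    rw [card_typeTuples hn] at h1
    refine le_of_mul_le_mul_left ?_ (mul_pos hpow hfac)
    linarith [hlink v]
  have hs := hstab _ (fiberDensity_mem_simplexOn hn φ) hlow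
  refine ⟨hφ, fun i => (hs i).1, fun v => ?_⟩
  rw [Finset.cast_card_sdiff (hφ.linkTuples_subset v), card_typeTuples hn]
  have h2 : P.pderiv (φ v) (fiberDensity φ) - (P.Phi - ε) ≤ 2 * η := by linarith [(hs (φ v)).2]
  have h3 := mul_le_mul_of_nonneg_left h2 (mul_pos hpow hfac).le
  linarith [hlink v]

theorem DenseHom.pow_le_card_comp {c η : ℝ} (hφ : P.DenseHom H φ c η) (hn : n ≠ 0) (hc : 0 ≤ c)
    {m : ℕ} (t : Fin m → Fin P.numV) :
    c ^ m * (n : ℝ) ^ m ≤ ((univ.filter fun s : Fin m → Fin n => φ ∘ s = t).card : ℝ) := by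
  rw [card_comp_eq hn, mul_comm]
  refine mul_le_mul_of_nonneg_left ?_ (by positivity)
  calc c ^ m = ∏ _k : Fin m, c := by simp
    _ ≤ _ := Finset.prod_le_prod (fun _ _ => hc) fun k _ => (hφ.lt_fiberDensity (t k)).le

/-- If `i` extends `f` to an edge of `P`, and `L` contains almost all tuples in the type of `i`,
then `L` contains a tuple of type `f`. -/
theorem DenseHom.exists_mem {c η θ : ℝ} (hφ : P.DenseHom H φ c η) (hn : n ≠ 0) (hc : 0 ≤ c)
    (hθ : θ < c ^ (r - 1)) {i : Fin P.numV} {f : Multiset (Fin P.numV)} (hf : i ::ₘ f ∈ P.E)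
    {L : Finset (Fin (r - 1) → Fin n)}
    (hL : ((P.typeTuples φ i \ L).card : ℝ) ≤ θ * (n : ℝ) ^ (r - 1)) :
    ∃ s ∈ L, univ.val.map (φ ∘ s) = f := by
  have hcard : Multiset.card f = r - 1 := by
    have := P.card_eq _ hf
    rw [Multiset.card_cons] at this
    omega
  obtain ⟨t, rfl⟩ := Multiset.exists_map_univ_eq_of_card_eq f hcard
  by_contra! hcon
  have hsub : (univ.filter fun s : Fin (r - 1) → Fin n => φ ∘ s = t) ⊆ P.typeTuples φ i \ L := by
    intro s hs
    have hst := (Finset.mem_filter.1 hs).2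
    refine Finset.mem_sdiff.2 ⟨Finset.mem_filter.2 ⟨Finset.mem_univ _, ?_⟩, fun hsL => ?_⟩
    · rwa [hst]
    · exact hcon s hsL (by rw [hst])
  have h1 : ((univ.filter fun s : Fin (r - 1) → Fin n => φ ∘ s = t).card : ℝ)
      ≤ (P.typeTuples φ i \ L).card := by
    exact_mod_cast Finset.card_le_card hsub
  have h2 := hφ.pow_le_card_comp hn hc t
  have h3 : θ * (n : ℝ) ^ (r - 1) < c ^ (r - 1) * (n : ℝ) ^ (r - 1) :=
    mul_lt_mul_of_pos_right hθ (by positivity)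
  linarith

theorem DenseHom.cons_mem {c η : ℝ} (hφ : P.DenseHom H φ c η) (hψ : P.DenseHom H ψ c η)
    (hn : n ≠ 0) (hc : 0 ≤ c) (hη : 2 * η < c ^ (r - 1)) {u v : Fin n} (huv : φ u = φ v)
    {f : Multiset (Fin P.numV)} (hf : ψ u ::ₘ f ∈ P.E) : ψ v ::ₘ f ∈ P.E := by
  have hsub : P.typeTuples ψ (ψ u) \ linkTuples r H v ⊆
      (P.typeTuples ψ (ψ u) \ linkTuples r H u) ∪ (P.typeTuples φ (φ v) \ linkTuples r H v) := by
    intro s hs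
    rw [Finset.mem_sdiff] at hs
    by_cases hsu : s ∈ linkTuples r H u
    · refine Finset.mem_union_right _ (Finset.mem_sdiff.2 ⟨?_, hs.2⟩)
      rw [← huv]
      exact hφ.hom.linkTuples_subset u hsu
    · exact Finset.mem_union_left _ (Finset.mem_sdiff.2 ⟨hs.1, hsu⟩)
  have hcard : ((P.typeTuples ψ (ψ u) \ linkTuples r H v).card : ℝ)
      ≤ (P.typeTuples ψ (ψ u) \ linkTuples r H u).card
        + (P.typeTuples φ (φ v) \ linkTuples r H v).card := by
    exact_mod_cast (Finset.card_le_card hsub).trans (Finset.card_union_le _ _)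
  obtain ⟨s, hs, rfl⟩ := hψ.exists_mem hn hc hη hf (L := linkTuples r H v)
    (by linarith [hψ.card_sdiff_le u, hφ.card_sdiff_le v])
  exact (Finset.mem_filter.1 (hψ.hom.linkTuples_subset v hs)).2

theorem DenseHom.eq_of_eq {c η : ℝ} (hφ : P.DenseHom H φ c η) (hψ : P.DenseHom H ψ c η)
    (hphi : 0 < P.phi) (hn : n ≠ 0) (hc : 0 ≤ c) (hη : 2 * η < c ^ (r - 1)) {u v : Fin n}
    (huv : φ u = φ v) : ψ u = ψ v :=
  Twins.eq hphi fun _ =>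
    ⟨hφ.cons_mem hψ hn hc hη huv, hφ.cons_mem hψ hn hc hη huv.symm⟩

theorem DenseHom.isPatternAut {c η : ℝ} (hφ : P.DenseHom H φ c η) (hψ : IsPatternHom P H ψ)
    (hsurj : Function.Surjective φ) (hn : n ≠ 0) (hc : 0 ≤ c) (hη : η < c ^ (r - 1))
    {σ : Equiv.Perm (Fin P.numV)} (hσ : ∀ v, ψ v = σ (φ v)) : IsPatternAut P σ := by
  intro e he
  induction e using Multiset.induction_on with
  | empty => exact he
  | cons i f =>
    obtain ⟨v, rfl⟩ := hsurj i
    obtain ⟨s, hs, rfl⟩ := hφ.exists_mem hn hc hη he (hφ.card_sdiff_le v)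
    have := (Finset.mem_filter.1 (hψ.linkTuples_subset v hs)).2
    rw [Multiset.map_cons, Multiset.map_map]
    rwa [hσ, show ψ ∘ s = σ ∘ φ ∘ s from funext fun k => hσ (s k)] at this

end Pattern

/-- Let `P` be a rigid `r`-pattern. Then there are `ε > 0` and `n₀` such that
for every `r`-graph `H` on `n ≥ n₀` vertices with `δ(H) ≥ (Φ_P - ε) n^{r-1}`,
any two surjective homomorphisms `φ, ψ` from `H` to `P` differ by an
automorphism of `P`: `ψ = σ ∘ φ`. -/
theorem surjective_hom_unique_of_isRigid (r : ℕ) (P : Pattern r)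
    (hrigid : P.IsRigid) :
    ∃ ε : ℝ, 0 < ε ∧ ∃ n₀ : ℕ, ∀ n : ℕ, n₀ ≤ n →
      ∀ H : Finset (Finset (Fin n)), (∀ e ∈ H, e.card = r) →
      (∀ v : Fin n, (P.Phi - ε) * (n : ℝ) ^ (r - 1)
        ≤ ((H.filter (fun e => v ∈ e)).card : ℝ)) →
      ∀ φ ψ : Fin n → Fin P.numV,
        IsPatternHom P H φ → Function.Surjective φ →
        IsPatternHom P H ψ → Function.Surjective ψ →
        ∃ σ : Equiv.Perm (Fin P.numV), IsPatternAut P σ ∧ ψ = fun v => σ (φ v) := by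
  set c : ℝ := P.phi / 2 with hc
  have hphi : 0 < P.phi := hrigid.1
  have hc0 : 0 < c := by positivity
  set η : ℝ := c ^ (r - 1) / (8 * (r - 1).factorial) with hη
  have hη0 : 0 < η := by positivity
  have hη' : 2 * (2 * (r - 1).factorial * η) < c ^ (r - 1) := by
    have h1 : 2 * (2 * (r - 1).factorial * η) = c ^ (r - 1) / 2 := by
      rw [hη]
      field_simp
      norm_num
    have h2 : 0 < c ^ (r - 1) := by positivity
    linarith
  obtain ⟨ε₀, hε₀, hstab⟩ := hrigid.exists_stability (c := c) (by linarith) hη0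
  refine ⟨min ε₀ η, lt_min hε₀ hη0, 0, fun n _ H hH hdeg φ ψ hφ hφs hψ hψs => ?_⟩
  have hn : n ≠ 0 := by
    rintro rfl
    obtain ⟨v, -⟩ := hφs ⟨0, P.pos⟩
    exact v.elim0
  have hstab' : ∀ x ∈ simplexOn P.numV, (∀ i, P.Phi - min ε₀ η ≤ P.pderiv i x) →
      ∀ i, c < x i ∧ P.pderiv i x < P.Phi + η := fun x hx h =>
    hstab x hx fun i => (sub_le_sub_left (min_le_left _ _) _).trans (h i)
  have hφd := hφ.denseHom hn (min_le_right _ _) hstab' hH hdeg hφs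
  have hψd := hψ.denseHom hn (min_le_right _ _) hstab' hH hdeg hψs
  obtain ⟨g, hg⟩ := hφs.hasRightInverse
  have hfactor : ∀ v, ψ v = ψ (g (φ v)) := fun v =>
    hφd.eq_of_eq hψd hphi hn hc0.le hη' (hg (φ v)).symm
  have hbij : Function.Bijective (ψ ∘ g) := by
    refine Finite.surjective_iff_bijective.1 fun j => ?_
    obtain ⟨v, rfl⟩ := hψs j
    exact ⟨φ v, (hfactor v).symm⟩
  refine ⟨Equiv.ofBijective _ hbij, ?_, funext hfactor⟩
  refine hφd.isPatternAut hψ hφs hn hc0.le ?_ hfactor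
  have : 0 < 2 * (r - 1).factorial * η := by positivity
  linarith
end
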